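/- Let C be a non-hyperelliptic smooth connected projective complex curve of genus g with a base-point-free tetragonal system T, presented as a complete intersection of divisors S_1 ∈ |O_X(2)(-aH)| and S_2 ∈ |O_X(2)(-bH)| on the 3-dimensional rational normal scroll X = P(V^∨), with a + b = g - 5 and T = H|_C. If a ≥ 2 and b ≥ 2 and moreover a = 2 or b = 2, then the algebra R_{K(-T)} is Koszul. (Indeed, for a ≥ 2 the homogeneous coordinate algebra of any divisor S ∈ |O_X(2)(-aH)| under the embedding defined by O_X(1)(-H) is Koszul, since its hyperplane section is a curve of genus g-5-a embedded by a complete linear system of degree 2g-10-a, and C is the intersection of S with a quadric.) In particular, R_{K(-T)} is Koszul whenever g = 9 or g = 10 and a, b ≥ 2. -/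

import Mathlib

open TensorProduct Function

noncomputable section


/-!  ### Graded algebras presented by their components

An ℕ-graded algebra `R = ⊕ₙ Rₙ` over a field `k` (with `R₀ = k`) is presented here through
its graded components, realized as `k`-subspaces `piece n` of an ambient `k`-algebra `A`,
with `1 ∈ piece 0` and `piece m * piece n ⊆ piece (m + n)`.  All notions below (Koszulness,
quadraticity) depend only on the components and the componentwise multiplication maps. -/
structure GradedSystem (k A : Type) [Field k] [Ring A] [Algebra k A] where
  piece : ℕ → Submodule k A
  one_mem : (1 : A) ∈ piece 0
  mul_mem : ∀ {m n : ℕ} {x y : A}, x ∈ piece m → y ∈ piece n → x * y ∈ piece (m + n)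

namespace GradedSystem

variable {k A : Type} [Field k] [Ring A] [Algebra k A] (S : GradedSystem k A)

/-- The componentwise multiplication map `Rₘ ⊗ Rₙ → R_{m+n}`. -/
def mulMap (m n : ℕ) : S.piece m →ₗ[k] S.piece n →ₗ[k] S.piece (m + n) :=
  LinearMap.mk₂ k (fun x y => ⟨(x : A) * (y : A), S.mul_mem x.2 y.2⟩)
    (fun x x' y => Subtype.ext (by simp [add_mul]))
    (fun c x y => Subtype.ext (by simp [smul_mul_assoc]))
    (fun x y y' => Subtype.ext (by simp [mul_add]))
    (fun c x y => Subtype.ext (by simp [mul_smul_comm]))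

/-- Transport of a graded component along an equality of degrees. -/
def cast {m n : ℕ} (h : m = n) : (S.piece m : Type) ≃ₗ[k] S.piece n :=
  LinearEquiv.ofEq _ _ (by rw [h])

/-- The degree-`d` component of the differential
`V_{i+1} ⊗ R(-(i+1)) → V_i ⊗ R(-i)` of a complex of free graded (right) `R`-modules with
`V_i = k^{n i}` generated in degree `i`; the differential is encoded by its
restriction `φ i : V_{i+1} → V_i ⊗ R₁` to the generators (a "matrix of linear forms").
The degree-`(i+1+d)` component of the map is `V_{i+1} ⊗ R_d → V_i ⊗ R_{d+1}`. -/
def Dmap (n : ℕ → ℕ)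
    (φ : ∀ i : ℕ, (Fin (n (i + 1)) → k) →ₗ[k] ((Fin (n i) → k) ⊗[k] S.piece 1))
    (i d : ℕ) :
    ((Fin (n (i + 1)) → k) ⊗[k] S.piece d) →ₗ[k] ((Fin (n i) → k) ⊗[k] S.piece (d + 1)) :=
  (LinearMap.lTensor (Fin (n i) → k)
      ((S.cast (add_comm 1 d)).toLinearMap ∘ₗ TensorProduct.lift (S.mulMap 1 d))) ∘ₗ
    (TensorProduct.assoc k (Fin (n i) → k) (S.piece 1) (S.piece d)).toLinearMap ∘ₗ
    (LinearMap.rTensor (S.piece d) (φ i))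

/-- `S` is connected: the degree-zero component is spanned by the unit, i.e. `R₀ = k`. -/
def ConnectedOne : Prop := S.piece 0 = Submodule.span k {(1 : A)}

/-- `S` is a *Koszul algebra*: `R₀ = k` and the trivial module `k` admits a linear free
resolution `⋯ → V₂ ⊗ R(-2) → V₁ ⊗ R(-1) → R → k → 0` (this is one of the standard
equivalent definitions of Koszulness: `Extⁿ(k, k(-m)) = 0` for `n ≠ m`).
Exactness is expressed by its graded components: surjectivity of `V₁ ⊗ R_d → R_{d+1}`
(exactness at `R` in positive degrees), injectivity of `V_{i+1} ⊗ R₀ → V_i ⊗ R₁`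
(exactness in the lowest degree at each spot), and `range = ker` elsewhere. -/
def IsKoszul : Prop :=
  S.ConnectedOne ∧
  ∃ (n : ℕ → ℕ)
    (φ : ∀ i : ℕ, (Fin (n (i + 1)) → k) →ₗ[k] ((Fin (n i) → k) ⊗[k] S.piece 1)),
    n 0 = 1 ∧
    (∀ d : ℕ, Surjective (S.Dmap n φ 0 d)) ∧
    (∀ i : ℕ, Injective (S.Dmap n φ i 0)) ∧
    (∀ i d : ℕ, LinearMap.range (S.Dmap n φ (i + 1) d) = LinearMap.ker (S.Dmap n φ i (d + 1)))

/-- `S` is a *quadratic algebra*: `R₀ = k`, `R` is generated by `R₁` and its relations are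
generated in degree `2`; equivalently there is an exact sequence
`V₂ ⊗ R(-2) → V₁ ⊗ R(-1) → R → k → 0` (exact at `V₁ ⊗ R(-1)` and at `R`). -/
def IsQuadratic : Prop :=
  S.ConnectedOne ∧
  ∃ (n : ℕ → ℕ)
    (φ : ∀ i : ℕ, (Fin (n (i + 1)) → k) →ₗ[k] ((Fin (n i) → k) ⊗[k] S.piece 1)),
    n 0 = 1 ∧
    (∀ d : ℕ, Surjective (S.Dmap n φ 0 d)) ∧
    Injective (S.Dmap n φ 0 0) ∧
    (∀ d : ℕ, LinearMap.range (S.Dmap n φ 1 d) = LinearMap.ker (S.Dmap n φ 0 (d + 1)))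

end GradedSystem

/-- For `m = 1`, the canonical identification `(k^m) ⊗ M ≃ M`. -/
def oneTensorEquiv {k : Type} [Field k] {m : ℕ} (h : m = 1) (M : Type)
    [AddCommGroup M] [Module k M] : ((Fin m → k) ⊗[k] M) ≃ₗ[k] M :=
  (TensorProduct.congr
      ((LinearEquiv.funCongrLeft k k (finCongr h.symm)).trans
        (LinearEquiv.funUnique (Fin 1) k k))
      (LinearEquiv.refl k M)).trans (TensorProduct.lid k M)


/-!  ### Smooth connected projective complex curves

A smooth connected projective curve over `ℂ` is (equivalently) presented through its
function field `F` — a finitely generated extension of `ℂ` of transcendence degree 1 —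
together with its set of points (= places of `F/ℂ`), each point giving an
order-of-vanishing valuation `ord P : F → ℤ`.  Divisors are finitely supported `ℤ`-valued
functions on points, and `H⁰(C, O(D))` is the Riemann–Roch space of `D`. -/
structure PreCurve where
  /-- the function field of the curve -/
  F : Type
  [fieldF : Field F]
  [algF : Algebra ℂ F]
  /-- `F` is a finitely generated extension of `ℂ` of transcendence degree 1 -/
  trdeg_one : ∃ x : F, Transcendental ℂ x ∧
    FiniteDimensional (IntermediateField.adjoin ℂ {x}) F
  /-- the (closed) points of the curve -/
  Point : Type
  /-- order of vanishing of a rational function at a point -/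
  ord : Point → F → ℤ
  ord_zero' : ∀ P, ord P 0 = 0
  ord_mul : ∀ P, ∀ f g : F, f ≠ 0 → g ≠ 0 → ord P (f * g) = ord P f + ord P g
  ord_add : ∀ P, ∀ f g : F, f ≠ 0 → g ≠ 0 → f + g ≠ 0 →
    min (ord P f) (ord P g) ≤ ord P (f + g)
  ord_algebraMap : ∀ P, ∀ c : ℂ, c ≠ 0 → ord P (algebraMap ℂ F c) = 0
  /-- every point admits a local uniformizer (the valuation is surjective) -/
  ord_uniformizer : ∀ P, ∃ f : F, f ≠ 0 ∧ ord P f = 1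
  /-- a nonzero rational function has only finitely many zeros and poles -/
  ord_finite_support : ∀ f : F, f ≠ 0 → (Function.support fun P => ord P f).Finite
  /-- distinct points are separated by rational functions -/
  ord_separates : ∀ P Q : Point, P ≠ Q → ∃ f : F, f ≠ 0 ∧ 0 < ord P f ∧ ord Q f = 0

attribute [instance] PreCurve.fieldF PreCurve.algF

namespace PreCurve

variable (C : PreCurve)

/-- Divisors on the curve. -/
abbrev Div := C.Point →₀ ℤ

/-- The divisor of a single point. -/
def pt (P : C.Point) : C.Div := Finsupp.single P 1

/-- The degree of a divisor. -/
def deg (D : C.Div) : ℤ := D.sum fun _ n => n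

/-- The Riemann–Roch space `H⁰(C, O(D)) = {f ∈ F | div f + D ≥ 0} ∪ {0}`. -/
def H0 (D : C.Div) : Submodule ℂ C.F where
  carrier := {f : C.F | f = 0 ∨ ∀ P, 0 ≤ C.ord P f + D P}
  zero_mem' := Or.inl rfl
  add_mem' := by
    intro f g hf hg
    rcases eq_or_ne f 0 with rfl | hf0
    · simpa using hg
    rcases eq_or_ne g 0 with rfl | hg0
    · simpa using hf
    rcases eq_or_ne (f + g) 0 with h0 | h0
    · exact Or.inl h0
    rcases hf with rfl | hf
    · exact absurd rfl hf0
    rcases hg with rfl | hg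
    · exact absurd rfl hg0
    refine Or.inr fun P => ?_
    have hmin := C.ord_add P f g hf0 hg0 h0
    rcases le_total (C.ord P f) (C.ord P g) with hle | hle
    · rw [min_eq_left hle] at hmin
      have := hf P; omega
    · rw [min_eq_right hle] at hmin
      have := hg P; omega
  smul_mem' := by
    intro c f hf
    rcases eq_or_ne c 0 with rfl | hc
    · exact Or.inl (zero_smul ℂ f)
    rcases hf with rfl | hf
    · exact Or.inl (smul_zero c)
    rcases eq_or_ne f 0 with rfl | hf0
    · exact Or.inl (smul_zero c)
    refine Or.inr fun P => ?_
    have hmap : (algebraMap ℂ C.F c) ≠ 0 := fun h =>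
      hc ((algebraMap ℂ C.F).injective (by rw [h, map_zero]))
    have hsm : c • f = algebraMap ℂ C.F c * f := Algebra.smul_def c f
    rw [hsm, C.ord_mul P _ f hmap hf0, C.ord_algebraMap P c hc]
    simpa using hf P

theorem mem_H0 {D : C.Div} {f : C.F} :
    f ∈ C.H0 D ↔ (f = 0 ∨ ∀ P, 0 ≤ C.ord P f + D P) := Iff.rfl

/-- `h⁰(D) = dim H⁰(C, O(D))`. -/
def h0 (D : C.Div) : ℕ := Module.finrank ℂ (C.H0 D)

theorem H0_mono {D E : C.Div} (h : ∀ P, D P ≤ E P) : C.H0 D ≤ C.H0 E := by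
  intro f hf
  rcases (C.mem_H0.mp hf) with rfl | hf
  · exact (C.H0 E).zero_mem
  · exact C.mem_H0.mpr (Or.inr fun P => by have := h P; have := hf P; omega)

theorem mul_mem_H0 {D E : C.Div} {f g : C.F} (hf : f ∈ C.H0 D) (hg : g ∈ C.H0 E) :
    f * g ∈ C.H0 (D + E) := by
  rcases (C.mem_H0.mp hf) with rfl | hf
  · exact C.mem_H0.mpr (Or.inl (zero_mul g))
  rcases (C.mem_H0.mp hg) with rfl | hg
  · exact C.mem_H0.mpr (Or.inl (mul_zero f))
  rcases eq_or_ne f 0 with rfl | hf0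
  · exact C.mem_H0.mpr (Or.inl (zero_mul g))
  rcases eq_or_ne g 0 with rfl | hg0
  · exact C.mem_H0.mpr (Or.inl (mul_zero f))
  refine C.mem_H0.mpr (Or.inr fun P => ?_)
  rw [C.ord_mul P f g hf0 hg0, Finsupp.add_apply]
  have := hf P; have := hg P; omega

/-- Multiplication of sections, `H⁰(D) ⊗ H⁰(E) → H⁰(D + E)`, as a bilinear map. -/
def mulH0 (D E : C.Div) : C.H0 D →ₗ[ℂ] C.H0 E →ₗ[ℂ] C.H0 (D + E) :=
  LinearMap.mk₂ ℂ (fun f g => ⟨(f : C.F) * (g : C.F), C.mul_mem_H0 f.2 g.2⟩)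
    (fun f f' g => Subtype.ext (by simp [add_mul]))
    (fun c f g => Subtype.ext (by simp [smul_mul_assoc]))
    (fun f g g' => Subtype.ext (by simp [mul_add]))
    (fun c f g => Subtype.ext (by simp [mul_smul_comm]))

/-- Transport of `H⁰` along an equality of divisors. -/
def castH0 {D E : C.Div} (h : D = E) : (C.H0 D : Type) ≃ₗ[ℂ] C.H0 E :=
  LinearEquiv.ofEq _ _ (by rw [h])

/-- The multiplication map `H⁰(D) ⊗ H⁰(E) → H⁰(G)` for `G = D + E`. -/
def mulTo (D E G : C.Div) (h : D + E = G) : (C.H0 D ⊗[ℂ] C.H0 E) →ₗ[ℂ] C.H0 G :=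
  (C.castH0 h).toLinearMap ∘ₗ TensorProduct.lift (C.mulH0 D E)

/-- The inclusion `H⁰(D) ⊆ H⁰(E)` for `D ≤ E`. -/
def inclH0 {D E : C.Div} (h : ∀ P, D P ≤ E P) : (C.H0 D : Type) →ₗ[ℂ] C.H0 E :=
  Submodule.inclusion (C.H0_mono h)

/-- Multiplication by a fixed section `a ∈ H⁰(E)`, as a map `H⁰(M) → H⁰(E + M)`. -/
def mulBy {E : C.Div} (a : C.F) (ha : a ∈ C.H0 E) (M : C.Div) :
    (C.H0 M : Type) →ₗ[ℂ] C.H0 (E + M) :=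
  C.mulH0 E M ⟨a, ha⟩

/-- The reduced effective divisor attached to a finite set of points. -/
def divOfFinset (s : Finset C.Point) : C.Div := ∑ P ∈ s, C.pt P

/-- The divisor of a nonzero rational function. -/
def divOf (f : C.F) : C.Div := by
  classical
  exact if h : f = 0 then 0
    else Finsupp.ofSupportFinite (fun P => C.ord P f) (C.ord_finite_support f h)

/-- Linear equivalence of divisors. -/
def LinEquiv (D E : C.Div) : Prop := ∃ f : C.F, f ≠ 0 ∧ D - E = C.divOf f

end PreCurve

/-- A smooth connected projective complex curve: the data of `PreCurve` together with
properness (principal divisors have degree zero), finite–dimensionality of Riemann–Roch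
spaces, `H⁰(O) = ℂ`, a canonical divisor `K`, and the genus, tied together by the
Riemann–Roch theorem (in its Serre-duality form `h⁰(D) − h⁰(K−D) = deg D + 1 − g`). -/
structure Curve extends PreCurve where
  deg_principal : ∀ f : toPreCurve.F, f ≠ 0 → (∑ᶠ P, toPreCurve.ord P f) = 0
  finiteDim : ∀ D : toPreCurve.Div, FiniteDimensional ℂ (toPreCurve.H0 D)
  h0_triv : toPreCurve.h0 0 = 1
  /-- a canonical divisor (class) of the curve -/
  K : toPreCurve.Div
  /-- the genus of the curve -/
  genus : ℕ
  riemann_roch : ∀ D : toPreCurve.Div,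
    (toPreCurve.h0 D : ℤ) - toPreCurve.h0 (K - D) = toPreCurve.deg D + 1 - genus

namespace Curve

variable (C : Curve)

/-- `h¹(D)`, via Serre duality. -/
def h1 (D : C.Div) : ℕ := C.h0 (C.K - D)

/-- The complete linear system `|D|` is base-point free. -/
def BasePointFree (D : C.Div) : Prop := ∀ P : C.Point, C.h0 (D - C.pt P) + 1 = C.h0 D

/-- `|D|` is a base-point-free pencil (base-point free of projective dimension 1). -/
def IsBPFPencil (D : C.Div) : Prop := C.BasePointFree D ∧ C.h0 D = 2

/-- `C` is hyperelliptic: it carries a `g¹₂`. -/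
def Hyperelliptic : Prop := ∃ D : C.Div, C.deg D = 2 ∧ 2 ≤ C.h0 D

/-- `C` is trigonal: it admits a degree-3 map to `ℙ¹`. -/
def Trigonal : Prop := ∃ D : C.Div, C.deg D = 3 ∧ 2 ≤ C.h0 D ∧ C.BasePointFree D

/-- `D` is very ample (it separates points and tangent vectors). -/
def VeryAmple (D : C.Div) : Prop :=
  ∀ P Q : C.Point, C.h0 (D - C.pt P - C.pt Q) + 2 = C.h0 D

/-- `C` is a smooth plane quintic: it carries a very ample `g²₅`. -/
def IsPlaneQuintic : Prop := ∃ D : C.Div, C.deg D = 5 ∧ C.h0 D = 3 ∧ C.VeryAmple D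

/-- The homogeneous coordinate algebra `R_L = ⊕ₙ H⁰(C, Lⁿ)` of a divisor (class) `L`,
as a graded system inside the function field. -/
def RL (L : C.Div) : GradedSystem ℂ C.F where
  piece n := C.H0 (n • L)
  one_mem := by
    refine C.mem_H0.mpr (Or.inr fun P => ?_)
    have h1 : C.ord P 1 = 0 := by
      simpa using C.ord_algebraMap P 1 one_ne_zero
    simp [h1]
  mul_mem := by
    intro m n x y hx hy
    have h := C.mul_mem_H0 hx hy
    show x * y ∈ C.H0 ((m + n) • L)
    rwa [add_smul]

/-- The embedding given by the complete linear system `|L|` is projectively normal: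
`R_L` is generated in degree one (equivalently, `Symⁿ H⁰(L) → H⁰(Lⁿ)` is surjective
for all `n`). -/
def ProjectivelyNormal (L : C.Div) : Prop :=
  ∀ n : ℕ, Surjective
    (C.mulTo L (n • L) ((n + 1) • L) ((add_comm L (n • L)).trans (succ_nsmul L n).symm))

end Curve

/-- The homology of a (two-step) complex `X → Y → Z` at `Y`. -/
def homol {X Y Z : Type} [AddCommGroup X] [AddCommGroup Y] [AddCommGroup Z]
    [Module ℂ X] [Module ℂ Y] [Module ℂ Z] (f : X →ₗ[ℂ] Y) (g : Y →ₗ[ℂ] Z) : Type :=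
  ↥(LinearMap.ker g) ⧸ Submodule.comap (LinearMap.ker g).subtype (LinearMap.range f)


/-!  ### Tetragonal curves on rational normal scrolls

A base-point-free tetragonal system `T` on a non-hyperelliptic curve `C` of genus `g`
embeds `C` (canonically) into the 3-dimensional rational normal scroll
`X = P(V^∨) → ℙ¹`, where `V = O(e 0) ⊕ O(e 1) ⊕ O(e 2)` is the rank-3 bundle on `ℙ¹`
defined as the kernel of the relative-duality surjection `π_* K_C → O(-2)`
(so `h⁰(V(-m)) = h⁰(K_C - mT)`).
We encode such a presentation concretely inside the function field of `C`:
`x` is an affine coordinate of the tetragonal pencil and `w i ∈ H⁰(K - (e i)·T)` is a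
generating section of the `i`-th summand of `V`; the sections of `O_X(n)(-mH)` are then
the polynomials in `x, w 0, w 1, w 2` of degree `n` in the `w`'s whose coefficient in
`x` is suitably bounded (the "admissible" polynomials below), and restriction to `C` is
evaluation in the function field. -/

/-- A monomial in the variables `X = var 0, W i = var i.succ` is admissible of bidegree
`(n, m)` (a monomial section of `O_X(n)(-mH)`) if it has degree `n` in the `W`'s and its
`X`-degree `k` satisfies `k + m ≤ ∑ (deg_{W i}) * e i`. -/
def admissible (e : Fin 3 → ℤ) (n : ℕ) (m : ℤ) (μ : Fin 4 →₀ ℕ) : Prop :=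
  (∑ i : Fin 3, μ i.succ) = n ∧ ((μ 0 : ℤ) + m ≤ ∑ i : Fin 3, (μ i.succ : ℤ) * e i)

/-- The space `H⁰(X, O_X(n)(-mH))` of sections of bidegree `(n,m)` on the scroll,
realized as the admissible polynomials in `ℂ[X, W 0, W 1, W 2]`. -/
def AdmSub (e : Fin 3 → ℤ) (n : ℕ) (m : ℤ) : Submodule ℂ (MvPolynomial (Fin 4) ℂ) where
  carrier := {p | ∀ μ ∈ p.support, admissible e n m μ}
  zero_mem' := by intro μ hμ; simp at hμ
  add_mem' := by
    intro p q hp hq μ hμ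
    rcases Finset.mem_union.mp (MvPolynomial.support_add hμ) with h | h
    · exact hp μ h
    · exact hq μ h
  smul_mem' := by
    intro c p hp μ hμ
    exact hp μ (MvPolynomial.support_smul hμ)

namespace Curve

variable (C : Curve)

/-- Substitution of the scroll coordinates: `X ↦ x`, `W i ↦ w i`. -/
def scrollVars (x : C.F) (w : Fin 3 → C.F) : Fin 4 → C.F := fun j => Fin.cases x w j

/-- Restriction of polynomial sections on the scroll to the curve: evaluation in the
function field. -/
def scrollEval (x : C.F) (w : Fin 3 → C.F) : MvPolynomial (Fin 4) ℂ →ₗ[ℂ] C.F :=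
  (MvPolynomial.aeval (C.scrollVars x w)).toLinearMap

end Curve

/-- A presentation of the pair `(C, T)` (tetragonal curve with base-point-free
tetragonal system, represented by an effective divisor `T`) on the rational normal
scroll of splitting type `e`. -/
structure ScrollData (C : Curve) (T : C.Div) (e : Fin 3 → ℤ) where
  /-- affine coordinate of the tetragonal pencil -/
  x : C.F
  /-- generating sections of the three line-bundle summands of `V ⊆ π_* K_C` -/
  w : Fin 3 → C.F
  /-- `{1, x}` spans the tetragonal pencil `H⁰(T)` -/
  pencil_span : Submodule.span ℂ {1, x} = C.H0 T
  /-- the `w i` are linearly independent over `ℂ[x]` (i.e. `V = ⊕ O(e i)` is a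
  subsheaf of `π_* K_C`) -/
  indep : LinearIndependent ℂ (fun q : Fin 3 × ℕ => x ^ q.2 * w q.1)
  /-- for every `m ≥ 0` the monomial sections `x^j * w i` with `j ≤ e i − m` span
  `H⁰(K − mT)`: this encodes `h⁰(V(−m)) = h⁰(K_C − mT)` together with the splitting
  type of `V` -/
  span_KmT : ∀ m : ℕ,
    Submodule.span ℂ
        {f : C.F | ∃ (i : Fin 3) (j : ℕ), (j : ℤ) ≤ e i - m ∧ f = x ^ j * w i} =
      C.H0 (C.K - m • T)

/-- `C` is the complete intersection of the divisors `S₁ = {Q₁ = 0} ∈ |O_X(2)(-aH)|`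
and `S₂ = {Q₂ = 0} ∈ |O_X(2)(-bH)|` on the scroll: both quadrics vanish on `C` and
together they generate the (bigraded) ideal of `C` on the scroll. -/
def ScrollData.CI {C : Curve} {T : C.Div} {e : Fin 3 → ℤ} (sd : ScrollData C T e)
    (a b : ℤ) (Q₁ Q₂ : MvPolynomial (Fin 4) ℂ) : Prop :=
  Q₁ ∈ AdmSub e 2 a ∧ Q₂ ∈ AdmSub e 2 b ∧
  C.scrollEval sd.x sd.w Q₁ = 0 ∧ C.scrollEval sd.x sd.w Q₂ = 0 ∧
  ∀ (n : ℕ) (m : ℤ), m ≤ 0 →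
    AdmSub e (n + 2) m ⊓ LinearMap.ker (C.scrollEval sd.x sd.w) =
      Submodule.map (LinearMap.mulLeft ℂ Q₁) (AdmSub e n (m - a)) ⊔
        Submodule.map (LinearMap.mulLeft ℂ Q₂) (AdmSub e n (m - b))

/-- The kernel of the restriction `H⁰(X, O_X(2)(-mH)) = H⁰(ℙ¹, S²V(-m)) → H⁰(C, 2K - mT)`,
i.e. `H⁰(ℙ¹, E(-m))` where `E = ker (S²V → π_*(K_C²))`. -/
def quadKer (C : Curve) {T : C.Div} {e : Fin 3 → ℤ} (sd : ScrollData C T e) (m : ℤ) :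
    Submodule ℂ (MvPolynomial (Fin 4) ℂ) :=
  AdmSub e 2 m ⊓ LinearMap.ker (C.scrollEval sd.x sd.w)

/-! ### Linear resolutions of graded modules -/

/-- A graded associative algebra over `k`, given by its components. -/
structure GRing (k : Type) [Field k] where
  R : ℕ → Type
  [acg : ∀ n, AddCommGroup (R n)]
  [mod : ∀ n, Module k (R n)]
  one : R 0
  mul : ∀ {l m n : ℕ}, l + m = n → R l →ₗ[k] R m →ₗ[k] R n
  one_mul' : ∀ {m : ℕ} (h : 0 + m = m) (a : R m), mul h one a = a
  mul_one' : ∀ {m : ℕ} (h : m + 0 = m) (a : R m), mul h a one = a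
  assoc : ∀ {i j l m n p : ℕ} (h₁ : i + j = m) (h₂ : m + l = n) (h₃ : j + l = p)
    (h₄ : i + p = n) (a : R i) (b : R j) (c : R l),
    mul h₂ (mul h₁ a b) c = mul h₄ a (mul h₃ b c)

attribute [instance] GRing.acg GRing.mod

/-- A graded right module over a graded algebra, given by its components. -/
structure GMod {k : Type} [Field k] (S : GRing k) where
  N : ℕ → Type
  [acg : ∀ n, AddCommGroup (N n)]
  [mod : ∀ n, Module k (N n)]
  act : ∀ {l m n : ℕ}, l + m = n → N l →ₗ[k] S.R m →ₗ[k] N n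
  act_one : ∀ {m : ℕ} (h : m + 0 = m) (x : N m), act h x S.one = x
  assoc : ∀ {i j l m n p : ℕ} (h₁ : i + j = m) (h₂ : m + l = n) (h₃ : j + l = p)
    (h₄ : i + p = n) (x : N i) (b : S.R j) (c : S.R l),
    act h₂ (act h₁ x b) c = act h₄ x (S.mul h₃ b c)

attribute [instance] GMod.acg GMod.mod

section LinRes

variable {k : Type} [Field k]

namespace GRing

variable (S : GRing k)

/-- The right action on the free module `V ⊗ S`. -/
def freeAct (V : Type) [AddCommGroup V] [Module k V] {l m n : ℕ} (h : l + m = n) :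
    (V ⊗[k] S.R l) →ₗ[k] S.R m →ₗ[k] (V ⊗[k] S.R n) :=
  ((LinearMap.lTensorHom V) ∘ₗ (S.mul h).flip).flip

@[simp] theorem freeAct_tmul (V : Type) [AddCommGroup V] [Module k V] {l m n : ℕ}
    (h : l + m = n) (v : V) (a : S.R l) (b : S.R m) :
    S.freeAct V h (v ⊗ₜ a) b = v ⊗ₜ S.mul h a b := rfl

/-- The degree-zero component is spanned by the unit. -/
def Connected : Prop := ∀ a : S.R 0, ∃ c : k, a = c • S.one

end GRing

namespace GMod

variable {S : GRing k}

/-- The structure map `N₀ ⊗ S_d → N_d`. -/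
def gmap (N : GMod S) (d : ℕ) : (N.N 0 ⊗[k] S.R d) →ₗ[k] N.N d :=
  TensorProduct.lift (N.act (zero_add d))

@[simp] theorem gmap_tmul (N : GMod S) (d : ℕ) (x : N.N 0) (a : S.R d) :
    N.gmap d (x ⊗ₜ a) = N.act (zero_add d) x a := rfl

theorem gmap_freeAct (N : GMod S) {l m n : ℕ} (h : l + m = n) (ω : N.N 0 ⊗[k] S.R l)
    (b : S.R m) : N.gmap n (S.freeAct _ h ω b) = N.act h (N.gmap l ω) b := by
  induction ω with
  | zero => simp
  | tmul x a => simp [N.assoc (zero_add l) h h (zero_add n)]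
  | add x y hx hy => simp [hx, hy]

/-- The first syzygy module, shifted to start in degree zero. -/
abbrev Omega (N : GMod S) : GMod S where
  N d := LinearMap.ker (N.gmap (d + 1))
  act {l m n} h := LinearMap.mk₂ k
    (fun ω b => ⟨S.freeAct _ (by omega) ω.1 b, by
      rw [LinearMap.mem_ker, gmap_freeAct, LinearMap.mem_ker.1 ω.2]; simp⟩)
    (fun _ _ _ => Subtype.ext (by simp)) (fun _ _ _ => Subtype.ext (by simp))
    (fun _ _ _ => Subtype.ext (by simp)) (fun _ _ _ => Subtype.ext (by simp))
  act_one {m} h x := by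
    refine Subtype.ext ?_
    obtain ⟨x, hx⟩ := x
    change S.freeAct _ _ x S.one = x
    clear hx
    induction x with
    | zero => simp
    | tmul x a => simp [S.mul_one']
    | add x y hx hy => simp [hx, hy]
  assoc {i j l m n p} h₁ h₂ h₃ h₄ x b c := by
    refine Subtype.ext ?_
    obtain ⟨x, hx⟩ := x
    change S.freeAct _ _ (S.freeAct _ _ x b) c = S.freeAct _ _ x (S.mul h₃ b c)
    clear hx
    induction x with
    | zero => simp
    | tmul x a =>
      simp only [GRing.freeAct_tmul]
      rw [S.assoc _ _ h₃]
    | add x y hx hy => simp [hx, hy]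

@[simp] theorem Omega_act_coe (N : GMod S) {l m n : ℕ} (h : l + m = n) (ω : N.Omega.N l)
    (b : S.R m) : (N.Omega.act h ω b).1 = S.freeAct (N.N 0) (by omega) ω.1 b := rfl

/-- `N` is generated in degree zero. -/
def Gen (N : GMod S) : Prop := ∀ d, Surjective (N.gmap d)

/-- `N` is generated in degree zero and the first `p` steps of its minimal free resolution
are linear. -/
def Lin : ℕ → GMod S → Prop
  | 0, _ => True
  | p + 1, N => N.Gen ∧ Lin p N.Omega

/-- Homomorphisms of graded modules. -/
structure Hom (N N' : GMod S) where
  f : ∀ d, N.N d →ₗ[k] N'.N d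
  comm : ∀ {l m n : ℕ} (h : l + m = n) (x : N.N l) (a : S.R m),
    f n (N.act h x a) = N'.act h (f l x) a

theorem Hom.gmap {N N' : GMod S} (φ : Hom N N') (d : ℕ) (ω : N.N 0 ⊗[k] S.R d) :
    N'.gmap d (LinearMap.rTensor _ (φ.f 0) ω) = φ.f d (N.gmap d ω) := by
  induction ω with
  | zero => simp
  | tmul x a => simp [φ.comm]
  | add x y hx hy => simp [hx, hy]

theorem rTensor_freeAct {V W : Type} [AddCommGroup V] [Module k V] [AddCommGroup W] [Module k W]
    (φ : V →ₗ[k] W) {l m n : ℕ} (h : l + m = n) (ω : V ⊗[k] S.R l) (b : S.R m) :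
    LinearMap.rTensor _ φ (S.freeAct V h ω b) = S.freeAct W h (LinearMap.rTensor _ φ ω) b := by
  induction ω with
  | zero => simp
  | tmul x a => simp
  | add x y hx hy => simp [hx, hy]

/-- Functoriality of syzygies. -/
def Hom.omega {N N' : GMod S} (φ : Hom N N') : Hom N.Omega N'.Omega where
  f d := (LinearMap.rTensor (S.R (d + 1)) (φ.f 0)).restrict fun ω hω => by
    rw [LinearMap.mem_ker, φ.gmap, LinearMap.mem_ker.1 hω, map_zero]
  comm h x a := Subtype.ext (rTensor_freeAct (φ.f 0) _ x.1 a)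

@[simp] theorem Hom.omega_coe {N N' : GMod S} (φ : Hom N N') (d : ℕ) (x : N.Omega.N d) :
    (φ.omega.f d x).1 = LinearMap.rTensor (S.R (d + 1)) (φ.f 0) x.1 := rfl

theorem Lin.mono {N : GMod S} {p q : ℕ} (h : N.Lin p) (hq : q ≤ p) : N.Lin q := by
  induction q generalizing N p with
  | zero => trivial
  | succ q ih =>
    obtain ⟨p, rfl⟩ : ∃ r, p = r + 1 := ⟨p - 1, by omega⟩
    exact ⟨h.1, ih h.2 (by omega)⟩

theorem Lin.of_subsingleton {N : GMod S} (h : ∀ d, Subsingleton (N.N d)) (p : ℕ) :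
    N.Lin p := by
  induction p generalizing N with
  | zero => trivial
  | succ p ih =>
    refine ⟨fun d x => ⟨0, Subsingleton.elim _ _⟩, ih fun d => ⟨fun x y => Subtype.ext ?_⟩⟩
    have : Subsingleton (N.N 0 ⊗[k] S.R (d + 1)) := ⟨fun a b => by
      have key : ∀ a : N.N 0 ⊗[k] S.R (d + 1), a = 0 := fun a => by
        induction a with
        | zero => rfl
        | tmul x a => rw [Subsingleton.elim x 0, zero_tmul]
        | add x y hx hy => rw [hx, hy, add_zero]
      rw [key a, key b]⟩
    exact Subsingleton.elim _ _

/-- Linearity is inherited by extensions. -/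
theorem Lin.ext {N' N N'' : GMod S} (φ : Hom N' N) (ψ : Hom N N'')
    (hφ : ∀ d, Injective (φ.f d)) (hψ : ∀ d, Surjective (ψ.f d))
    (hex : ∀ d, Exact (φ.f d) (ψ.f d)) {p : ℕ} (h' : N'.Lin p) (h'' : N''.Lin p) :
    N.Lin p := by
  induction p generalizing N' N N'' with
  | zero => trivial
  | succ p ih =>
    have lift : ∀ d (x : N.N d) (ω : N.N 0 ⊗[k] S.R d),
        N''.gmap d (LinearMap.rTensor _ (ψ.f 0) ω) = ψ.f d x →
        ∃ η : N'.N 0 ⊗[k] S.R d, N.gmap d (ω + LinearMap.rTensor _ (φ.f 0) η) = x := by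
      intro d x ω hω
      rw [ψ.gmap, ← sub_eq_zero, ← map_sub] at hω
      obtain ⟨y, hy⟩ := (hex d _).1 hω
      obtain ⟨η, rfl⟩ := h'.1 d y
      refine ⟨-η, ?_⟩
      rw [map_add, φ.gmap, map_neg, map_neg, hy]
      abel
    refine ⟨fun d x => ?_, ih φ.omega ψ.omega ?_ ?_ ?_ h'.2 h''.2⟩
    · obtain ⟨ω'', h1⟩ := h''.1 d (ψ.f d x)
      obtain ⟨ω, rfl⟩ := LinearMap.rTensor_surjective (S.R d) (hψ 0) ω''
      obtain ⟨η, hη⟩ := lift d x ω h1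
      exact ⟨_, hη⟩
    · intro d x y hxy
      refine Subtype.ext (Module.Flat.rTensor_preserves_injective_linearMap _ (hφ 0) ?_)
      exact congrArg Subtype.val hxy
    · intro d ω''
      obtain ⟨ω, hω⟩ := LinearMap.rTensor_surjective (S.R (d + 1)) (hψ 0) ω''.1
      obtain ⟨η, hη⟩ := lift (d + 1) 0 ω (by
        rw [hω, LinearMap.mem_ker.1 ω''.2, map_zero])
      refine ⟨⟨_, hη⟩, Subtype.ext ?_⟩
      rw [Hom.omega_coe, map_add, hω, ← LinearMap.comp_apply, ← LinearMap.rTensor_comp,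
        (hex 0).linearMap_comp_eq_zero]
      simp
    · intro d ω
      constructor
      · intro h0
        obtain ⟨η, hη⟩ := (rTensor_exact (S.R (d + 1)) (hex 0) (hψ 0) ω.1).1
          (congrArg Subtype.val h0)
        refine ⟨⟨η, ?_⟩, Subtype.ext hη⟩
        apply hφ (d + 1)
        rw [← φ.gmap, hη, map_zero, LinearMap.mem_ker.1 ω.2]
      · rintro ⟨η, rfl⟩
        refine Subtype.ext ?_
        rw [Hom.omega_coe, Hom.omega_coe, ← LinearMap.comp_apply, ← LinearMap.rTensor_comp,
          (hex 0).linearMap_comp_eq_zero]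
        simp

/-- The zero module. -/
abbrev zeroMod (S : GRing k) : GMod S where
  N _ := PUnit
  act _ := 0
  act_one _ _ := rfl
  assoc _ _ _ _ _ _ _ := rfl

theorem Lin.of_bijective {N N' : GMod S} (φ : Hom N N') (hφ : ∀ d, Bijective (φ.f d)) {p : ℕ}
    (h : N.Lin p) : N'.Lin p :=
  Lin.ext (N'' := zeroMod S) φ ⟨fun _ => 0, fun _ _ _ => rfl⟩ (fun d => (hφ d).1)
    (fun _ _ => ⟨0, rfl⟩) (fun d x => ⟨fun _ => (hφ d).2 x, fun _ => rfl⟩) h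
    (Lin.of_subsingleton (fun _ => inferInstanceAs (Subsingleton PUnit)) p)

/-- A linear module modulo a submodule that is linear starting in degree one is linear. -/
theorem Lin.quot {M L L' : GMod S} (ψ : Hom L L') (ι : ∀ d, M.N d →ₗ[k] L.N (d + 1))
    (hιc : ∀ {l m n : ℕ} (h : l + m = n) (h' : l + 1 + m = n + 1) (x : M.N l) (a : S.R m),
      ι n (M.act h x a) = L.act h' (ι l x) a)
    (hι : ∀ d, Injective (ι d)) (hψ : ∀ d, Surjective (ψ.f d)) (hψ0 : Injective (ψ.f 0))
    (hex : ∀ d, Exact (ι d) (ψ.f (d + 1))) {p : ℕ} (hM : M.Lin p) (hL : L.Lin (p + 1)) :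
    L'.Lin (p + 1) := by
  let e0 : L.N 0 ≃ₗ[k] L'.N 0 := LinearEquiv.ofBijective (ψ.f 0) ⟨hψ0, hψ 0⟩
  let E (d : ℕ) : (L.N 0 ⊗[k] S.R d) ≃ₗ[k] (L'.N 0 ⊗[k] S.R d) := LinearEquiv.rTensor _ e0
  have hE (d) (ω) : E d ω = LinearMap.rTensor _ (ψ.f 0) ω := rfl
  have hEg (d) (ω) : ψ.f d (L.gmap d ((E d).symm ω)) = L'.gmap d ω := by
    rw [← ψ.gmap, ← hE, LinearEquiv.apply_symm_apply]
  have hmem (d) (ω : L'.Omega.N d) :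
      L.gmap (d + 1) ((E (d + 1)).symm ω.1) ∈ LinearMap.range (ι d) :=
    (hex d _).1 (by rw [hEg, LinearMap.mem_ker.1 ω.2])
  let δ (d : ℕ) : L'.Omega.N d →ₗ[k] M.N d :=
    (LinearEquiv.ofInjective (ι d) (hι d)).symm.toLinearMap ∘ₗ
      LinearMap.codRestrict (LinearMap.range (ι d))
        (L.gmap (d + 1) ∘ₗ (E (d + 1)).symm.toLinearMap ∘ₗ
          (LinearMap.ker (L'.gmap (d + 1))).subtype) (hmem d)
  have hδ (d) (ω : L'.Omega.N d) : ι d (δ d ω) = L.gmap (d + 1) ((E (d + 1)).symm ω.1) := by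
    have := LinearEquiv.apply_symm_apply (LinearEquiv.ofInjective (ι d) (hι d))
      ⟨_, hmem d ω⟩
    exact congrArg Subtype.val this
  have hEact {l m n : ℕ} (h : l + m = n) (ω) (a : S.R m) :
      (E n).symm (S.freeAct _ h ω a) = S.freeAct _ h ((E l).symm ω) a := by
    rw [LinearEquiv.symm_apply_eq, hE, rTensor_freeAct, ← hE, LinearEquiv.apply_symm_apply]
  refine ⟨fun d x => ?_, Lin.ext (N' := L.Omega) (N'' := M) ψ.omega ⟨δ, ?_⟩ ?_ ?_ ?_ hL.2 hM⟩
  · obtain ⟨y, rfl⟩ := hψ d x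
    obtain ⟨ω, rfl⟩ := hL.1 d y
    exact ⟨_, ψ.gmap d ω⟩
  · intro l m n h x a
    apply hι
    have h' : l + 1 + m = n + 1 := by omega
    rw [hδ, hιc h h', hδ, Omega_act_coe, hEact, gmap_freeAct]
  · intro d x y hxy
    exact Subtype.ext ((E (d + 1)).injective (congrArg Subtype.val hxy))
  · intro d m
    obtain ⟨ω, hω⟩ := hL.1 (d + 1) (ι d m)
    refine ⟨⟨E (d + 1) ω, ?_⟩, ?_⟩
    · rw [LinearMap.mem_ker, hE, ψ.gmap, hω]
      exact (hex d _).2 ⟨m, rfl⟩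
    · apply hι
      change ι d (δ d _) = _
      rw [hδ, LinearEquiv.symm_apply_apply, hω]
  · intro d ω
    change δ d ω = 0 ↔ _
    rw [← (hι d).eq_iff, hδ, map_zero]
    constructor
    · intro h0
      exact ⟨⟨_, h0⟩, Subtype.ext ((E (d + 1)).apply_symm_apply ω.1)⟩
    · rintro ⟨η, rfl⟩
      rw [Hom.omega_coe, ← hE, LinearEquiv.symm_apply_apply]
      exact η.2

/-- A graded algebra as a module over itself. -/
abbrev self (S : GRing k) : GMod S where
  N := S.R
  act h := S.mul h
  act_one h x := S.mul_one' h x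
  assoc h₁ h₂ h₃ h₄ x b c := S.assoc h₁ h₂ h₃ h₄ x b c

/-- The augmentation ideal, shifted to start in degree zero. -/
abbrev plus (S : GRing k) : GMod S where
  N d := S.R (d + 1)
  act {l m n} h := S.mul (show l + 1 + m = n + 1 by omega)
  act_one h x := S.mul_one' _ x
  assoc h₁ h₂ h₃ h₄ x b c := S.assoc _ _ _ _ x b c

theorem Lin.self (hS : S.Connected) (p : ℕ) : (GMod.self S).Lin p := by
  have key (d : ℕ) (ω : (GMod.self S).N 0 ⊗[k] S.R d) :
      ω = S.one ⊗ₜ[k] ((GMod.self S).gmap d ω) := by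
    induction ω with
    | zero => simp
    | tmul x a =>
      obtain ⟨c, rfl⟩ := hS x
      rw [gmap_tmul]
      change (c • S.one) ⊗ₜ[k] a = S.one ⊗ₜ[k] (S.mul _ (c • S.one) a)
      rw [map_smul, LinearMap.smul_apply, S.one_mul', tmul_smul, smul_tmul']
    | add x y hx hy => rw [map_add, tmul_add, ← hx, ← hy]
  cases p with
  | zero => trivial
  | succ p =>
    refine ⟨fun d x => ⟨S.one ⊗ₜ x, S.one_mul' _ x⟩, Lin.of_subsingleton (fun d => ⟨?_⟩) p⟩
    have h0 (x : (GMod.self S).Omega.N d) : x = 0 := Subtype.ext (by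
      rw [key _ x.1, LinearMap.mem_ker.1 x.2, tmul_zero]; rfl)
    intro x y
    rw [h0 x, h0 y]

/-- The module `V ⊗ M`. -/
abbrev tens (V : Type) [AddCommGroup V] [Module k V] (M : GMod S) : GMod S where
  N d := V ⊗[k] M.N d
  act h := ((LinearMap.lTensorHom V) ∘ₗ (M.act h).flip).flip
  act_one h x := by
    induction x with
    | zero => simp
    | tmul v a => simp [M.act_one]
    | add x y hx hy => simp only [map_add, LinearMap.add_apply, hx, hy]
  assoc h₁ h₂ h₃ h₄ x b c := by
    induction x with
    | zero => simp
    | tmul v a => simp [M.assoc h₁ h₂ h₃ h₄]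
    | add x y hx hy => simp only [map_add, LinearMap.add_apply, hx, hy]

theorem tens_act_tmul (V : Type) [AddCommGroup V] [Module k V] (M : GMod S) {l m n : ℕ}
    (h : l + m = n) (v : V) (x : M.N l) (a : S.R m) :
    (tens V M).act h (v ⊗ₜ x : V ⊗[k] M.N l) a = (v ⊗ₜ M.act h x a : V ⊗[k] M.N n) := rfl

theorem Lin.tens (V : Type) [AddCommGroup V] [Module k V] {M : GMod S} {p : ℕ} (hM : M.Lin p) :
    (GMod.tens V M).Lin p := by
  induction p generalizing M with
  | zero => trivial
  | succ p ih =>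
    let a (d : ℕ) : ((V ⊗[k] M.N 0) ⊗[k] S.R d) ≃ₗ[k] (V ⊗[k] (M.N 0 ⊗[k] S.R d)) :=
      TensorProduct.assoc k V (M.N 0) (S.R d)
    have ha (d) (ω) : (GMod.tens V M).gmap d ((a d).symm ω) = LinearMap.lTensor V (M.gmap d) ω := by
      induction ω with
      | zero => simp
      | tmul v η =>
        induction η with
        | zero => simp
        | tmul x s => rfl
        | add x y hx hy => rw [tmul_add, map_add, map_add, map_add, hx, hy]
      | add x y hx hy => rw [map_add, map_add, map_add, hx, hy]
    refine ⟨fun d x => ?_, ?_⟩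
    · obtain ⟨ω, hω⟩ := LinearMap.lTensor_surjective V (hM.1 d) x
      exact ⟨(a d).symm ω, by rw [ha, hω]⟩
    · have hex (d : ℕ) : Exact (LinearMap.lTensor V (LinearMap.ker (M.gmap d)).subtype)
          (LinearMap.lTensor V (M.gmap d)) :=
        lTensor_exact V (LinearMap.exact_subtype_ker_map _) (hM.1 d)
      let f (d : ℕ) : (GMod.tens V M.Omega).N d →ₗ[k] (GMod.tens V M).Omega.N d :=
        LinearMap.codRestrict _ ((a (d + 1)).symm.toLinearMap ∘ₗ
          LinearMap.lTensor V (LinearMap.ker (M.gmap (d + 1))).subtype) (fun ω => by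
            rw [LinearMap.mem_ker]
            refine (ha _ _).trans ?_
            exact (hex (d + 1) _).2 ⟨ω, rfl⟩)
      have hf (d) (ω) : (f d ω).1 = (a (d + 1)).symm
          (LinearMap.lTensor V (LinearMap.ker (M.gmap (d + 1))).subtype ω) := rfl
      refine Lin.of_bijective (N := GMod.tens V M.Omega) ⟨f, ?_⟩ (fun d => ⟨?_, ?_⟩) (ih hM.2)
      · intro l m n h x b
        refine Subtype.ext ?_
        rw [Omega_act_coe, hf, hf]
        induction x using TensorProduct.induction_on with
        | zero => simp
        | tmul v x =>
          obtain ⟨x, hx⟩ := x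
          rw [tens_act_tmul, LinearMap.lTensor_tmul, LinearMap.lTensor_tmul]
          change (a (n + 1)).symm (v ⊗ₜ S.freeAct _ _ x b) =
            S.freeAct _ _ ((a (l + 1)).symm (v ⊗ₜ x)) b
          clear hx
          induction x with
          | zero => simp
          | tmul y s => rfl
          | add x y hx hy => simp only [map_add, LinearMap.add_apply, tmul_add, hx, hy]
        | add x y hx hy => simp only [map_add, LinearMap.add_apply, hx, hy]
      · intro x y hxy
        refine Module.Flat.lTensor_preserves_injective_linearMap (M := V) _
          (Submodule.injective_subtype _) ((a (d + 1)).symm.injective ?_)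
        exact congrArg Subtype.val hxy
      · intro ω
        obtain ⟨η, hη⟩ := (hex (d + 1) (a (d + 1) ω.1)).1 (by
          rw [← ha, LinearEquiv.symm_apply_apply]
          exact ω.2)
        refine ⟨η, Subtype.ext ?_⟩
        rw [hf, hη, LinearEquiv.symm_apply_apply]

end GMod

/-- Homomorphisms of graded algebras. -/
structure GRing.Hom (S R : GRing k) where
  f : ∀ d, S.R d →ₗ[k] R.R d
  map_one : f 0 S.one = R.one
  map_mul : ∀ {l m n : ℕ} (h : l + m = n) (a : S.R l) (b : S.R m),
    f n (S.mul h a b) = R.mul h (f l a) (f m b)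

namespace GMod

variable {S R : GRing k}

/-- Restriction of scalars. -/
abbrev pull (π : GRing.Hom S R) (N : GMod R) : GMod S where
  N := N.N
  act {l m n} h := (N.act h).compl₂ (π.f m)
  act_one h x := by simp [π.map_one, N.act_one]
  assoc h₁ h₂ h₃ h₄ x b c := by
    simp only [LinearMap.compl₂_apply]
    rw [N.assoc h₁ h₂ h₃ h₄, π.map_mul]

theorem pull_gmap (π : GRing.Hom S R) (N : GMod R) (d : ℕ) (ω : N.N 0 ⊗[k] S.R d) :
    (pull π N).gmap d ω = N.gmap d (LinearMap.lTensor (N.N 0) (π.f d) ω) := by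
  induction ω with
  | zero => exact (map_zero _).trans (by simp)
  | tmul x a => rfl
  | add x y hx hy => rw [map_add, map_add, map_add, hx, hy]

/-- If `R = S / I` where `I` has a `2`-linear resolution over `S`, then an `R`-module that
is linear over `S` is linear over `R`. -/
theorem Lin.descend (π : GRing.Hom S R) (hπ : ∀ d, Surjective (π.f d)) (hπ1 : Injective (π.f 1))
    (M : GMod S) (ι : ∀ d, M.N d →ₗ[k] S.R (d + 2))
    (hιc : ∀ {l m n : ℕ} (h : l + m = n) (h' : l + 2 + m = n + 2) (x : M.N l) (a : S.R m),
      ι n (M.act h x a) = S.mul h' (ι l x) a)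
    (hι : ∀ d, Injective (ι d)) (hex : ∀ d, Exact (ι d) (π.f (d + 2)))
    (hM : ∀ p, M.Lin p) (N : GMod R) (hN : ∀ p, (pull π N).Lin p) (p : ℕ) : N.Lin p := by
  induction p generalizing N with
  | zero => trivial
  | succ p ih =>
    have hgen : N.Gen := fun d x => by
      obtain ⟨ω, hω⟩ := (hN 1).1 d x
      exact ⟨_, (pull_gmap π N d ω).symm.trans hω⟩
    refine ⟨hgen, ih _ fun q => ?_⟩
    have hq : (pull π N.Omega).Lin (q + 1) := by
      let g (d : ℕ) : (pull π N).Omega.N d →ₗ[k] (pull π N.Omega).N d :=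
        LinearMap.restrict (LinearMap.lTensor (N.N 0) (π.f (d + 1))) (fun ω hω => by
          rw [LinearMap.mem_ker, ← pull_gmap]
          exact hω)
      have hg (d) (ω : (pull π N).Omega.N d) :
          (show N.Omega.N d from g d ω).1 = LinearMap.lTensor (N.N 0) (π.f (d + 1)) ω.1 := rfl
      have hex' (d : ℕ) : Exact (LinearMap.lTensor (N.N 0) (ι d))
          (LinearMap.lTensor (N.N 0) (π.f (d + 2))) := lTensor_exact _ (hex d) (hπ _)
      let j (d : ℕ) : (GMod.tens (N.N 0) M).N d →ₗ[k] (pull π N).Omega.N (d + 1) :=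
        LinearMap.codRestrict _ (LinearMap.lTensor (N.N 0) (ι d)) (fun ω => by
          rw [LinearMap.mem_ker]
          refine (pull_gmap _ _ _ _).trans ?_
          rw [(hex' d _).2 ⟨ω, rfl⟩, map_zero])
      have hj (d) (ω) : (j d ω).1 = LinearMap.lTensor (N.N 0) (ι d) ω := rfl
      refine Lin.quot (M := GMod.tens (N.N 0) M) (L := (pull π N).Omega) ⟨g, ?_⟩ j ?_ ?_ ?_ ?_ ?_
        ((hM q).tens _) (hN (q + 2)).2
      · intro l m n h x a
        refine Subtype.ext ?_
        obtain ⟨x, hx⟩ := x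
        change LinearMap.lTensor (N.N 0) (π.f (n + 1)) (S.freeAct (N.N 0) _ x a) =
          R.freeAct (N.N 0) _ (LinearMap.lTensor (N.N 0) (π.f (l + 1)) x) (π.f m a)
        clear hx
        induction x using TensorProduct.induction_on with
        | zero => simp
        | tmul x s => simp [π.map_mul]
        | add x y hx hy => simp only [map_add, LinearMap.add_apply, hx, hy]
      · intro l m n h h' x a
        refine Subtype.ext ?_
        rw [Omega_act_coe, hj, hj]
        induction x using TensorProduct.induction_on with
        | zero => simp
        | tmul x s =>
          rw [tens_act_tmul, LinearMap.lTensor_tmul, LinearMap.lTensor_tmul]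
          rw [hιc h (by omega)]
          rfl
        | add x y hx hy => simp only [map_add, LinearMap.add_apply, hx, hy]
      · intro d x y hxy
        exact Module.Flat.lTensor_preserves_injective_linearMap (M := N.N 0) _ (hι d)
          (congrArg Subtype.val hxy)
      · intro d ω
        obtain ⟨η, hη⟩ := LinearMap.lTensor_surjective (N.N 0) (hπ (d + 1)) ω.1
        refine ⟨⟨η, ?_⟩, Subtype.ext hη⟩
        rw [LinearMap.mem_ker]
        refine (pull_gmap _ _ _ _).trans ?_
        rw [hη]
        exact ω.2
      · intro x y hxy
        exact Subtype.ext (Module.Flat.lTensor_preserves_injective_linearMap (M := N.N 0) _ hπ1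
          (congrArg Subtype.val hxy))
      · intro d ω
        constructor
        · intro h0
          obtain ⟨η, hη⟩ := (hex' d ω.1).1 (congrArg Subtype.val h0)
          exact ⟨η, Subtype.ext hη⟩
        · rintro ⟨η, rfl⟩
          exact Subtype.ext ((hex' d _).2 ⟨η, rfl⟩)
    exact hq.mono (by omega)

/-- Koszulness passes from `S` to `S / I` when `I` has a `2`-linear resolution over `S`. -/
theorem Lin.plus_descend (π : GRing.Hom S R) (hπ : ∀ d, Surjective (π.f d))
    (hπ1 : Injective (π.f 1)) (M : GMod S) (ι : ∀ d, M.N d →ₗ[k] S.R (d + 2))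
    (hιc : ∀ {l m n : ℕ} (h : l + m = n) (h' : l + 2 + m = n + 2) (x : M.N l) (a : S.R m),
      ι n (M.act h x a) = S.mul h' (ι l x) a)
    (hι : ∀ d, Injective (ι d)) (hex : ∀ d, Exact (ι d) (π.f (d + 2)))
    (hM : ∀ p, M.Lin p) (hS : ∀ p, (plus S).Lin p) (p : ℕ) : (plus R).Lin p := by
  refine Lin.descend π hπ hπ1 M ι hιc hι hex hM _ (fun q => Lin.mono (p := q + 1) ?_ (by omega)) p
  exact Lin.quot (M := M) (L := plus S) (L' := pull π (plus R))
    ⟨fun d => π.f (d + 1), fun _ x a => π.map_mul _ x a⟩ ι (fun h _ x a => hιc h _ x a) hι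
    (fun d => hπ (d + 1)) hπ1 hex (hM q) (hS (q + 1))

end GMod

end LinRes

/-! ### Koszulness from linearity of the augmentation ideal -/

namespace GradedSystem

variable {k A : Type} [Field k] [Ring A] [Algebra k A] (S : GradedSystem k A)

/-- The graded algebra underlying a graded system. -/
abbrev ring : GRing k where
  R n := S.piece n
  one := ⟨1, S.one_mem⟩
  mul h := LinearMap.mk₂ k (fun x y => ⟨(x : A) * (y : A), h ▸ S.mul_mem x.2 y.2⟩)
    (fun x x' y => Subtype.ext (by simp [add_mul]))
    (fun c x y => Subtype.ext (by simp))
    (fun x y y' => Subtype.ext (by simp [mul_add]))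
    (fun c x y => Subtype.ext (by simp))
  one_mul' _ a := Subtype.ext (one_mul (a : A))
  mul_one' _ a := Subtype.ext (mul_one (a : A))
  assoc _ _ _ _ a b c := Subtype.ext (mul_assoc (a : A) b c)

theorem ConnectedOne.ring {S : GradedSystem k A} (h : S.ConnectedOne) : S.ring.Connected := by
  rintro ⟨a, ha⟩
  rw [h] at ha
  obtain ⟨c, rfl⟩ := Submodule.mem_span_singleton.1 ha
  exact ⟨c, rfl⟩

end GradedSystem

/-- A stage of a linear resolution: a module embedded in `V ⊗ R₊`. -/
structure ResStage {k : Type} [Field k] (R : GRing k) where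
  V : Type
  [acg : AddCommGroup V]
  [mod : Module k V]
  [fin : FiniteDimensional k V]
  N : GMod R
  j : ∀ d, N.N d →ₗ[k] V ⊗[k] R.R (d + 1)
  inj : ∀ d, Injective (j d)
  equivariant : ∀ {l m n : ℕ} (h : l + m = n) (h' : l + 1 + m = n + 1) (x : N.N l) (a : R.R m),
    j n (N.act h x a) = R.freeAct V h' (j l x) a

attribute [instance] ResStage.acg ResStage.mod ResStage.fin

namespace ResStage

variable {k : Type} [Field k] {R : GRing k}

/-- The augmentation ideal inside `k ⊗ R`. -/
def start (R : GRing k) : ResStage R where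
  V := k
  N := GMod.plus R
  j d := (TensorProduct.lid k (R.R (d + 1))).symm.toLinearMap
  inj d := (TensorProduct.lid k (R.R (d + 1))).symm.injective
  equivariant h h' x a := by simp

variable [FiniteDimensional k (R.R 1)]

/-- Passing to the first syzygy. -/
def next (s : ResStage R) : ResStage R where
  V := s.N.N 0
  fin := FiniteDimensional.of_injective (s.j 0) (s.inj 0)
  N := s.N.Omega
  j d := (LinearMap.ker (s.N.gmap (d + 1))).subtype
  inj _ := Submodule.injective_subtype _
  equivariant _ _ _ _ := rfl

/-- The stages of the minimal linear resolution of the trivial module. -/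
def stage (R : GRing k) [FiniteDimensional k (R.R 1)] : ℕ → ResStage R
  | 0 => start R
  | i + 1 => (stage R i).next

theorem stage_lin (h : ∀ p, (GMod.plus R).Lin p) (i p : ℕ) : (stage R i).N.Lin p := by
  induction i generalizing p with
  | zero => exact h p
  | succ i ih => exact (ih (p + 1)).2

end ResStage

namespace GMod

variable {k : Type} [Field k] {R : GRing k}

theorem gmap_zero_injective (hR : R.Connected) (N : GMod R) : Injective (N.gmap 0) := by
  have key (ω : N.N 0 ⊗[k] R.R 0) : ω = N.gmap 0 ω ⊗ₜ R.one := by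
    induction ω with
    | zero => simp
    | tmul x a =>
      obtain ⟨c, rfl⟩ := hR a
      rw [gmap_tmul, map_smul, N.act_one, tmul_smul, smul_tmul']
    | add x y hx hy => rw [map_add, add_tmul, ← hx, ← hy]
  intro x y hxy
  rw [key x, key y, hxy]

end GMod

namespace GradedSystem

variable {k A : Type} [Field k] [Ring A] [Algebra k A] (S : GradedSystem k A)

theorem lTensor_mulMap_assoc (V : Type) [AddCommGroup V] [Module k V] (d : ℕ)
    (h : 1 + d = d + 1) (η : V ⊗[k] S.piece 1) (a : S.piece d) :
    LinearMap.lTensor V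
      ((S.cast (add_comm 1 d)).toLinearMap ∘ₗ TensorProduct.lift (S.mulMap 1 d))
      (TensorProduct.assoc k V (S.piece 1) (S.piece d) (η ⊗ₜ a)) = S.ring.freeAct V h η a := by
  induction η with
  | zero => simp
  | tmul v b => rfl
  | add x y hx hy => simp only [add_tmul, map_add, LinearMap.add_apply, hx, hy]

open ResStage

theorem isKoszul_of_lin (h0 : S.ConnectedOne) [FiniteDimensional k (S.piece 1)]
    (hlin : ∀ p, (GMod.plus S.ring).Lin p) : S.IsKoszul := by
  let st := stage S.ring
  let n : ℕ → ℕ := fun i => Module.finrank k (st i).V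
  let e (i : ℕ) : (st i).V ≃ₗ[k] (Fin (n i) → k) := (Module.finBasis k (st i).V).equivFun
  let φ (i : ℕ) : (Fin (n (i + 1)) → k) →ₗ[k] ((Fin (n i) → k) ⊗[k] S.piece 1) :=
    LinearMap.rTensor _ (e i).toLinearMap ∘ₗ (st i).j 0 ∘ₗ (e (i + 1)).symm.toLinearMap
  let E (i d : ℕ) : ((st i).V ⊗[k] S.piece d) ≃ₗ[k] ((Fin (n i) → k) ⊗[k] S.piece d) :=
    LinearEquiv.rTensor _ (e i)
  let G (i d : ℕ) : ((st (i + 1)).V ⊗[k] S.piece d) →ₗ[k] ((st i).V ⊗[k] S.piece (d + 1)) :=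
    (st i).j d ∘ₗ (st i).N.gmap d
  have hD' (i d : ℕ) (ω : (st (i + 1)).V ⊗[k] S.piece d) :
      S.Dmap n φ i d (E (i + 1) d ω) = E i (d + 1) (G i d ω) := by
    induction ω with
    | zero => simp only [map_zero]
    | tmul v a =>
      have h1 : S.Dmap n φ i d (E (i + 1) d (v ⊗ₜ a)) = LinearMap.lTensor (Fin (n i) → k)
          ((S.cast (add_comm 1 d)).toLinearMap ∘ₗ TensorProduct.lift (S.mulMap 1 d))
          (TensorProduct.assoc k _ (S.piece 1) (S.piece d) (φ i (e (i + 1) v) ⊗ₜ a)) := rfl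
      have h2 : φ i (e (i + 1) v) = LinearMap.rTensor _ (e i).toLinearMap ((st i).j 0 v) :=
        congrArg (fun u => LinearMap.rTensor _ (e i).toLinearMap ((st i).j 0 u))
          ((e (i + 1)).symm_apply_apply v)
      rw [h1, lTensor_mulMap_assoc _ _ _ (add_comm 1 d), h2, ← GMod.rTensor_freeAct]
      refine congrArg (E i (d + 1)) ?_
      exact ((st i).equivariant (zero_add d) (by omega) v a).symm
    | add x y hx hy => simp only [map_add, hx, hy]
  have hD (i d : ℕ) (ω : (st (i + 1)).V ⊗[k] S.piece d) :
      S.Dmap n φ i d (E (i + 1) d ω) = E i (d + 1) ((st i).j d ((st i).N.gmap d ω)) := hD' i d ω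
  have hgen (i d) : Surjective ((st i).N.gmap d) := (stage_lin hlin i 1).1 d
  refine ⟨h0, n, φ, Module.finrank_self k, fun d => ?_, fun i => ?_, fun i d => ?_⟩
  · intro y
    obtain ⟨y, rfl⟩ := (E 0 (d + 1)).surjective y
    obtain ⟨x, rfl⟩ : ∃ x, (st 0).j d x = y :=
      (TensorProduct.lid k (S.piece (d + 1))).symm.surjective y
    obtain ⟨ω, rfl⟩ := hgen 0 d x
    exact ⟨_, hD 0 d ω⟩
  · rw [injective_iff_map_eq_zero]
    intro ω hω
    obtain ⟨ω, rfl⟩ := (E (i + 1) 0).surjective ω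
    rw [hD, LinearEquiv.map_eq_zero_iff] at hω
    have h1 : (st i).N.gmap 0 ω = 0 := (st i).inj 0 (hω.trans (map_zero _).symm)
    have h2 : ω = 0 := GMod.gmap_zero_injective h0.ring _ (h1.trans (map_zero _).symm)
    rw [h2, map_zero]
  · ext ω
    obtain ⟨ω, rfl⟩ := (E (i + 1) (d + 1)).surjective ω
    rw [LinearMap.mem_ker, hD, LinearEquiv.map_eq_zero_iff]
    constructor
    · rintro ⟨η, hη⟩
      obtain ⟨η, rfl⟩ := (E (i + 2) d).surjective η
      have := (E (i + 1) (d + 1)).injective ((hD (i + 1) d η).symm.trans hη)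
      rw [← this]
      have h1 : (st i).N.gmap (d + 1) ((st (i + 1)).j d ((st (i + 1)).N.gmap d η)) = 0 :=
        ((st (i + 1)).N.gmap d η).2
      rw [h1, map_zero]
    · intro hω
      have h1 : (st i).N.gmap (d + 1) ω = 0 := (st i).inj _ (hω.trans (map_zero _).symm)
      obtain ⟨η, hη⟩ := hgen (i + 1) d ⟨ω, h1⟩
      refine ⟨E (i + 2) d η, (hD (i + 1) d η).trans ?_⟩
      refine congrArg (E (i + 1) (d + 1)) ?_
      exact congrArg Subtype.val hη

end GradedSystem

/-! ### Polynomials supported on a set of monomials -/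

namespace Scroll

/-- Polynomials supported on a set of monomials. -/
def mon (s : Set (Fin 4 →₀ ℕ)) : Submodule ℂ (MvPolynomial (Fin 4) ℂ) where
  carrier := {p | ∀ μ ∈ p.support, μ ∈ s}
  zero_mem' := by intro μ hμ; simp at hμ
  add_mem' := by
    intro p q hp hq μ hμ
    rcases Finset.mem_union.mp (MvPolynomial.support_add hμ) with h | h
    · exact hp μ h
    · exact hq μ h
  smul_mem' := by
    intro c p hp μ hμ
    exact hp μ (MvPolynomial.support_smul hμ)

theorem mem_mon {s : Set (Fin 4 →₀ ℕ)} {p : MvPolynomial (Fin 4) ℂ} :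
    p ∈ mon s ↔ ∀ μ ∈ p.support, μ ∈ s := Iff.rfl

theorem mem_mon_iff_coeff {s : Set (Fin 4 →₀ ℕ)} {p : MvPolynomial (Fin 4) ℂ} :
    p ∈ mon s ↔ ∀ μ ∉ s, p.coeff μ = 0 := by
  simp only [mem_mon, MvPolynomial.mem_support_iff]
  exact forall_congr' fun μ => not_imp_comm

theorem mul_mem_mon {s t u : Set (Fin 4 →₀ ℕ)} {p q : MvPolynomial (Fin 4) ℂ} (hp : p ∈ mon s)
    (hq : q ∈ mon t) (h : ∀ μ ∈ s, ∀ ν ∈ t, μ + ν ∈ u) : p * q ∈ mon u := by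
  classical
  intro μ hμ
  obtain ⟨ν, hν, ν', hν', rfl⟩ := Finset.mem_add.1 (MvPolynomial.support_mul p q hμ)
  exact h _ (hp _ hν) _ (hq _ hν')

theorem monomial_mem_mon {s : Set (Fin 4 →₀ ℕ)} {μ : Fin 4 →₀ ℕ} (h : μ ∈ s) (c : ℂ) :
    MvPolynomial.monomial μ c ∈ mon s := by
  classical
  intro ν hν
  rw [Finset.mem_singleton.1 (MvPolynomial.support_monomial_subset hν)]
  exact h

/-- Exact division of a polynomial by a monomial. -/
theorem exists_eq_monomial_mul {s t : Set (Fin 4 →₀ ℕ)} {x₀ : Fin 4 →₀ ℕ}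
    {p : MvPolynomial (Fin 4) ℂ} (hp : p ∈ mon s) (h : ∀ μ ∈ s, ∃ ν ∈ t, μ = x₀ + ν) :
    ∃ q ∈ mon t, p = MvPolynomial.monomial x₀ 1 * q := by
  refine ⟨p.divMonomial x₀, fun ν hν => ?_, ?_⟩
  · rw [MvPolynomial.mem_support_iff, MvPolynomial.coeff_divMonomial] at hν
    obtain ⟨ν', hν', h'⟩ := h _ (hp _ (MvPolynomial.mem_support_iff.2 hν))
    rwa [add_left_cancel h']
  · ext μ
    rw [MvPolynomial.coeff_monomial_mul', one_mul, MvPolynomial.coeff_divMonomial]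
    split_ifs with hμ
    · rw [add_tsub_cancel_of_le hμ]
    · by_contra h0
      obtain ⟨ν, -, rfl⟩ := h _ (hp _ (MvPolynomial.mem_support_iff.2 h0))
      exact hμ le_self_add

open Classical in
/-- Truncation of a polynomial to a set of monomials. -/
def tr (s : Set (Fin 4 →₀ ℕ)) : MvPolynomial (Fin 4) ℂ →ₗ[ℂ] MvPolynomial (Fin 4) ℂ :=
  (MvPolynomial.basisMonomials (Fin 4) ℂ).constr ℂ fun μ =>
    if μ ∈ s then MvPolynomial.monomial μ 1 else 0

open Classical in
theorem coeff_tr (s : Set (Fin 4 →₀ ℕ)) (p : MvPolynomial (Fin 4) ℂ) (μ : Fin 4 →₀ ℕ) :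
    (tr s p).coeff μ = if μ ∈ s then p.coeff μ else 0 := by
  have key : MvPolynomial.lcoeff ℂ μ ∘ₗ tr s =
      if μ ∈ s then MvPolynomial.lcoeff ℂ μ else 0 := by
    refine (MvPolynomial.basisMonomials (Fin 4) ℂ).ext fun ν => ?_
    rw [LinearMap.comp_apply, tr, Module.Basis.constr_basis, MvPolynomial.coe_basisMonomials]
    by_cases hν : ν = μ
    · subst hν
      split_ifs <;> simp
    · split_ifs <;> simp [hν]
  have := LinearMap.congr_fun key p
  rw [LinearMap.comp_apply, MvPolynomial.lcoeff_apply] at this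
  rw [this]
  split_ifs <;> rfl

theorem tr_mem (s : Set (Fin 4 →₀ ℕ)) (p : MvPolynomial (Fin 4) ℂ) : tr s p ∈ mon s := by
  rw [mem_mon_iff_coeff]
  intro μ hμ
  rw [coeff_tr, if_neg hμ]

theorem tr_of_mem {s : Set (Fin 4 →₀ ℕ)} {p : MvPolynomial (Fin 4) ℂ} (hp : p ∈ mon s) :
    tr s p = p := by
  ext μ
  rw [coeff_tr]
  split_ifs with h
  · rfl
  · exact (mem_mon_iff_coeff.1 hp μ h).symm

theorem tr_eq_zero_iff {s : Set (Fin 4 →₀ ℕ)} {p : MvPolynomial (Fin 4) ℂ} :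
    tr s p = 0 ↔ p ∈ mon sᶜ := by
  rw [mem_mon_iff_coeff, MvPolynomial.ext_iff]
  refine forall_congr' fun μ => ?_
  rw [coeff_tr, Set.notMem_compl_iff]
  split_ifs with h <;> simp [h]

theorem sub_tr_mem {s t : Set (Fin 4 →₀ ℕ)} {p : MvPolynomial (Fin 4) ℂ} (hp : p ∈ mon t) :
    p - tr s p ∈ mon (t \ s) := by
  rw [mem_mon_iff_coeff] at hp ⊢
  intro μ hμ
  rw [MvPolynomial.coeff_sub, coeff_tr]
  split_ifs with h
  · exact sub_self _
  · rw [hp μ fun h' => hμ ⟨h', h⟩, sub_zero]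

/-- Truncation may be postponed when the discarded part contributes nothing. -/
theorem tr_congr_sub {s : Set (Fin 4 →₀ ℕ)} {p q : MvPolynomial (Fin 4) ℂ}
    (h : q - p ∈ mon sᶜ) : tr s p = tr s q := by
  rw [← sub_eq_zero, ← neg_eq_zero, neg_sub, ← map_sub, tr_eq_zero_iff]
  exact h

/-- Truncation with values in the truncated polynomials. -/
def cut (s : Set (Fin 4 →₀ ℕ)) : MvPolynomial (Fin 4) ℂ →ₗ[ℂ] mon s :=
  (tr s).codRestrict (mon s) (tr_mem s)

/-! ### Monomial modules over the toric algebra of the scroll -/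

/-- The degree of a monomial in the fibre coordinates. -/
def len (μ : Fin 4 →₀ ℕ) : ℕ := ∑ i : Fin 3, μ i.succ

/-- The largest power of `X` allowed by the fibre coordinates of a monomial. -/
def wt (e : Fin 3 → ℤ) (μ : Fin 4 →₀ ℕ) : ℤ := ∑ i : Fin 3, (μ i.succ : ℤ) * (e i - 1)

theorem len_add (μ ν : Fin 4 →₀ ℕ) : len (μ + ν) = len μ + len ν := by
  simp [len, Finset.sum_add_distrib]

theorem wt_add (e : Fin 3 → ℤ) (μ ν : Fin 4 →₀ ℕ) : wt e (μ + ν) = wt e μ + wt e ν := by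
  simp [wt, add_mul, Finset.sum_add_distrib]

/-- Admissible monomials of degree `(n, n)`. -/
def adm (e : Fin 3 → ℤ) (n : ℕ) : Set (Fin 4 →₀ ℕ) := {μ | admissible e n n μ}

theorem sum_mul_eq_wt (e : Fin 3 → ℤ) (μ : Fin 4 →₀ ℕ) :
    ∑ i : Fin 3, (μ i.succ : ℤ) * e i = wt e μ + len μ := by
  simp [wt, len, mul_sub, Finset.sum_sub_distrib]

theorem admissible_iff {e : Fin 3 → ℤ} {n : ℕ} {m : ℤ} {μ : Fin 4 →₀ ℕ} :
    admissible e n m μ ↔ len μ = n ∧ (μ 0 : ℤ) + m ≤ wt e μ + len μ := by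
  rw [admissible, sum_mul_eq_wt]
  rfl

theorem mem_adm {e : Fin 3 → ℤ} {n : ℕ} {μ : Fin 4 →₀ ℕ} :
    μ ∈ adm e n ↔ len μ = n ∧ (μ 0 : ℤ) ≤ wt e μ := by
  change admissible e n n μ ↔ _
  rw [admissible_iff]
  omega

theorem AdmSub_mul_mem {e : Fin 3 → ℤ} {n n' n'' : ℕ} {m m' m'' : ℤ}
    {p q : MvPolynomial (Fin 4) ℂ} (hp : p ∈ AdmSub e n m) (hq : q ∈ AdmSub e n' m')
    (hn : n + n' = n'') (hm : m'' ≤ m + m') : p * q ∈ AdmSub e n'' m'' := by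
  refine mul_mem_mon (s := {μ | admissible e n m μ}) (t := {μ | admissible e n' m' μ})
    (u := {μ | admissible e n'' m'' μ}) hp hq fun μ hμ ν hν => ?_
  simp only [Set.mem_ofPred_eq, admissible_iff, len_add, wt_add, Finsupp.add_apply] at *
  omega

theorem one_mem_AdmSub (e : Fin 3 → ℤ) : (1 : MvPolynomial (Fin 4) ℂ) ∈ AdmSub e 0 0 :=
  monomial_mem_mon (s := {μ | admissible e 0 0 μ}) (by simp [admissible]) 1

/-- The toric algebra of the scroll in the polarization `O(1)(-H)`. -/
def toric (e : Fin 3 → ℤ) : GradedSystem ℂ (MvPolynomial (Fin 4) ℂ) where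
  piece n := AdmSub e n n
  one_mem := one_mem_AdmSub e
  mul_mem hx hy := AdmSub_mul_mem hx hy rfl (by push_cast; rfl)

theorem wt_eq_zero {e : Fin 3 → ℤ} {μ : Fin 4 →₀ ℕ} (h : ∀ i, μ (Fin.succ i) ≠ 0 → e i = 1) :
    wt e μ = 0 := by
  refine Finset.sum_eq_zero fun i _ => ?_
  by_cases hi : μ i.succ = 0
  · simp [hi]
  · simp [h i hi]

theorem len_eq_zero {μ : Fin 4 →₀ ℕ} (h : len μ = 0) (i : Fin 3) : μ i.succ = 0 :=
  Finset.sum_eq_zero_iff.1 h i (Finset.mem_univ i)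

theorem mem_adm_zero {e : Fin 3 → ℤ} {μ : Fin 4 →₀ ℕ} : μ ∈ adm e 0 ↔ μ = 0 := by
  rw [mem_adm]
  constructor
  · rintro ⟨h, h0⟩
    have h1 := len_eq_zero h
    rw [wt_eq_zero fun i hi => absurd (h1 i) hi] at h0
    ext j
    refine Fin.cases ?_ (fun i => ?_) j
    · simpa using h0
    · simpa using h1 i
  · rintro rfl
    simp [len, wt]

theorem toric_connected (e : Fin 3 → ℤ) : (toric e).ring.Connected := by
  rintro ⟨p, hp⟩
  refine ⟨p.coeff 0, Subtype.ext ?_⟩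
  change p = p.coeff 0 • 1
  ext μ
  by_cases h : μ = 0
  · simp [h]
  · rw [mem_mon_iff_coeff (s := adm e 0) |>.1 hp μ (mt mem_adm_zero.1 h)]
    simp [MvPolynomial.coeff_one, Ne.symm h]

/-- A family of sets of monomials carrying a module structure over the toric algebra, with
products falling outside of the family being zero. -/
structure MonMod (e : Fin 3 → ℤ) where
  u : ℕ → Set (Fin 4 →₀ ℕ)
  conv : ∀ {l m m' : ℕ} {μ ν ν' : Fin 4 →₀ ℕ}, μ ∈ u l → ν ∈ adm e m → ν' ∈ adm e m' →
    μ + ν + ν' ∈ u (l + m + m') → μ + ν ∈ u (l + m)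

namespace MonMod

variable {e : Fin 3 → ℤ}

/-- The module attached to a family of sets of monomials. -/
abbrev toGMod (U : MonMod e) : GMod (toric e).ring where
  N d := mon (U.u d)
  act {_ _ n} _ := LinearMap.mk₂ ℂ (fun x y => cut (U.u n) (x.1 * y.1))
    (fun x x' y => by simp [add_mul]) (fun c x y => by simp)
    (fun x y y' => by simp [mul_add]) (fun c x y => by simp)
  act_one h x := by
    refine Subtype.ext ?_
    change tr _ (x.1 * 1) = x.1
    rw [mul_one, tr_of_mem x.2]
  assoc {i j l m n p} h₁ h₂ h₃ h₄ x b c := by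
    subst h₁ h₂
    refine Subtype.ext ?_
    change tr _ (tr _ (x.1 * b.1) * c.1) = tr _ (x.1 * (b.1 * c.1))
    refine tr_congr_sub ?_
    rw [← mul_assoc, ← sub_mul]
    refine mul_mem_mon (sub_tr_mem (t := {μ | ∃ μ₁ ∈ U.u i, ∃ ν ∈ adm e j, μ = μ₁ + ν})
      (mul_mem_mon x.2 (t := adm e j) b.2 fun μ hμ ν hν => ⟨μ, hμ, ν, hν, rfl⟩))
      (t := adm e l) c.2 ?_
    rintro _ ⟨⟨μ, hμ, ν, hν, rfl⟩, h⟩ ν' hν' h'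
    exact h (U.conv hμ hν hν' h')

theorem act_coe (U : MonMod e) {l m n : ℕ} (h : l + m = n) (x : U.toGMod.N l)
    (a : (toric e).piece m) : (U.toGMod.act h x a).1 = tr (U.u n) (x.1 * a.1) := rfl

/-- Linearity from a filtration by a translated monomial module. -/
theorem lin_ext {U U₁ U₂ : MonMod e} (x₀ : Fin 4 →₀ ℕ)
    (h₁ : ∀ d, ∀ ν ∈ U₁.u d, x₀ + ν ∈ U.u d) (h₂ : ∀ d, U₂.u d ⊆ U.u d)
    (h₁₂ : ∀ d, ∀ ν ∈ U₁.u d, x₀ + ν ∉ U₂.u d)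
    (hU : ∀ d, ∀ μ ∈ U.u d, μ ∈ U₂.u d ∨ ∃ ν ∈ U₁.u d, μ = x₀ + ν)
    (hc : ∀ l m, ∀ ν ∈ U₁.u l, ∀ α ∈ adm e m, x₀ + (ν + α) ∈ U.u (l + m) → ν + α ∈ U₁.u (l + m))
    {p : ℕ} (hp₁ : U₁.toGMod.Lin p) (hp₂ : U₂.toGMod.Lin p) : U.toGMod.Lin p := by
  let X : MvPolynomial (Fin 4) ℂ := MvPolynomial.monomial x₀ 1
  have hX : X ∈ mon {x₀} := monomial_mem_mon (Set.mem_singleton x₀) 1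
  have hX0 : X ≠ 0 := by simp [X]
  have hmem (d) (y : U₁.toGMod.N d) : X * y.1 ∈ mon (U.u d) :=
    mul_mem_mon hX y.2 (by rintro _ rfl ν hν; exact h₁ d ν hν)
  let φ (d : ℕ) : U₁.toGMod.N d →ₗ[ℂ] U.toGMod.N d :=
    (LinearMap.mulLeft ℂ X ∘ₗ (mon (U₁.u d)).subtype).codRestrict _ (hmem d)
  let ψ (d : ℕ) : U.toGMod.N d →ₗ[ℂ] U₂.toGMod.N d := cut (U₂.u d) ∘ₗ (mon (U.u d)).subtype
  have hφ (d) (y : U₁.toGMod.N d) : (φ d y).1 = X * y.1 := rfl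
  have hψ (d) (y : U.toGMod.N d) : (ψ d y).1 = tr (U₂.u d) y.1 := rfl
  refine GMod.Lin.ext (N' := U₁.toGMod) (N'' := U₂.toGMod) ⟨φ, ?_⟩ ⟨ψ, ?_⟩ ?_ ?_ ?_ hp₁ hp₂
  · intro l m n h x a
    subst h
    refine Subtype.ext ?_
    rw [hφ, act_coe, act_coe, hφ, ← tr_of_mem (hmem (l + m) ⟨_, tr_mem _ _⟩)]
    refine tr_congr_sub ?_
    rw [mul_assoc, ← mul_sub]
    refine mul_mem_mon hX (sub_tr_mem (t := {μ | ∃ ν ∈ U₁.u l, ∃ α ∈ adm e m, μ = ν + α})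
      (mul_mem_mon x.2 (t := adm e m) a.2 fun μ hμ ν hν => ⟨μ, hμ, ν, hν, rfl⟩)) ?_
    rintro _ rfl _ ⟨⟨ν, hν, α, hα, rfl⟩, h⟩ h'
    exact h (hc l m ν hν α hα h')
  · intro l m n h x a
    subst h
    refine Subtype.ext ?_
    rw [hψ, act_coe, act_coe, hψ]
    trans tr (U₂.u (l + m)) (x.1 * a.1)
    · refine tr_congr_sub ?_
      have := sub_tr_mem (s := U.u (l + m)) (t := Set.univ) (p := x.1 * a.1) (fun _ _ => trivial)
      exact fun μ hμ h => (this μ hμ).2 (h₂ _ h)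
    · refine (tr_congr_sub ?_).symm
      rw [← sub_mul]
      refine mul_mem_mon (sub_tr_mem x.2) (t := adm e m) a.2 ?_
      rintro μ ⟨hμ, hμ2⟩ α hα h
      obtain ⟨ν, hν, rfl⟩ := (hU l μ hμ).resolve_left hμ2
      have h3 := h₂ _ h
      rw [add_assoc] at h h3
      exact h₁₂ _ _ (hc l m ν hν α hα h3) h
  · intro d x y hxy
    exact Subtype.ext (mul_left_cancel₀ hX0 (congrArg Subtype.val hxy))
  · intro d y
    exact ⟨⟨y.1, fun μ hμ => h₂ d (y.2 μ hμ)⟩, Subtype.ext (tr_of_mem y.2)⟩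
  · intro d x
    constructor
    · intro h
      have h3 : x.1 ∈ mon (U₂.u d)ᶜ := tr_eq_zero_iff.1 (congrArg Subtype.val h)
      obtain ⟨q, hq, hx⟩ := exists_eq_monomial_mul (s := U.u d \ U₂.u d) (t := U₁.u d) (x₀ := x₀)
        (fun μ hμ => ⟨x.2 μ hμ, h3 μ hμ⟩) (fun μ hμ => (hU d μ hμ.1).resolve_left hμ.2)
      exact ⟨⟨q, hq⟩, Subtype.ext hx.symm⟩
    · rintro ⟨y, rfl⟩
      refine Subtype.ext (tr_eq_zero_iff.2 ?_)
      refine mul_mem_mon hX y.2 ?_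
      rintro _ rfl ν hν
      exact h₁₂ d ν hν

theorem lin_of_empty {U : MonMod e} (h : ∀ d, ∀ μ, μ ∉ U.u d) (p : ℕ) : U.toGMod.Lin p := by
  refine GMod.Lin.of_subsingleton (fun d => ?_) p
  have key (x : U.toGMod.N d) : x.1 = 0 := by
    rw [← MvPolynomial.support_eq_empty, Finset.eq_empty_iff_forall_notMem]
    exact fun μ hμ => h d μ (x.2 μ hμ)
  exact ⟨fun x y => Subtype.ext ((key x).trans (key y).symm)⟩

/-- Linearity of a cyclic module from linearity of its annihilator. -/
theorem lin_cyclic {U J : MonMod e} (x₀ : Fin 4 →₀ ℕ) (h0 : x₀ ∈ U.u 0)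
    (hU : ∀ d, ∀ μ ∈ U.u d, ∃ ν ∈ adm e d, μ = x₀ + ν)
    (hJ : ∀ d ν, ν ∈ J.u d ↔ ν ∈ adm e (d + 1) ∧ x₀ + ν ∉ U.u (d + 1))
    {p : ℕ} (hp : J.toGMod.Lin p) : U.toGMod.Lin (p + 1) := by
  let X : MvPolynomial (Fin 4) ℂ := MvPolynomial.monomial x₀ 1
  have hX : X ∈ mon {x₀} := monomial_mem_mon (Set.mem_singleton x₀) 1
  let ψ (d : ℕ) : (GMod.self (toric e).ring).N d →ₗ[ℂ] U.toGMod.N d :=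
    cut (U.u d) ∘ₗ LinearMap.mulLeft ℂ X ∘ₗ ((toric e).piece d).subtype
  have hψ (d) (a : (toric e).piece d) : (ψ d a).1 = tr (U.u d) (X * a.1) := rfl
  have hJs (d) : mon (J.u d) ≤ (toric e).piece (d + 1) := fun p hp μ hμ =>
    ((hJ d μ).1 (hp μ hμ)).1
  have hup {l m : ℕ} {ν α : Fin 4 →₀ ℕ} (hν : ν ∈ adm e l) (hα : α ∈ adm e m)
      (h : x₀ + ν ∉ U.u l) : x₀ + (ν + α) ∉ U.u (l + m) := by
    intro h'
    have := U.conv h0 hν hα (by rwa [zero_add, add_assoc x₀])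
    rw [zero_add] at this
    exact h this
  let ι (d : ℕ) : J.toGMod.N d →ₗ[ℂ] (GMod.self (toric e).ring).N (d + 1) :=
    Submodule.inclusion (hJs d)
  refine GMod.Lin.quot (M := J.toGMod) (L := GMod.self (toric e).ring) ⟨ψ, ?_⟩ ι ?_ ?_ ?_ ?_ ?_
    hp (GMod.Lin.self (toric_connected e) _)
  · intro l m n h x a
    subst h
    refine Subtype.ext ?_
    change tr _ (X * (x.1 * a.1)) = tr _ (tr _ (X * x.1) * a.1)
    refine (tr_congr_sub ?_).symm
    rw [← mul_assoc, ← sub_mul]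
    refine mul_mem_mon (sub_tr_mem (t := {μ | ∃ ν ∈ adm e l, μ = x₀ + ν})
      (mul_mem_mon hX (t := adm e l) x.2 ?_)) (t := adm e m) a.2 ?_
    · rintro _ rfl ν hν
      exact ⟨ν, hν, rfl⟩
    · rintro _ ⟨⟨ν, hν, rfl⟩, h⟩ α hα
      rw [Set.mem_compl_iff, add_assoc]
      exact hup hν hα h
  · intro l m n h h' x a
    subst h
    refine Subtype.ext ?_
    change tr _ (x.1 * a.1) = x.1 * a.1
    refine tr_of_mem (mul_mem_mon x.2 (t := adm e m) a.2 fun ν hν α hα => ?_)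
    rw [hJ] at hν ⊢
    have h1 := hup hν.1 hα hν.2
    rw [show l + 1 + m = l + m + 1 by omega] at h1
    refine ⟨?_, h1⟩
    have h2 := hν.1
    rw [mem_adm] at h2 hα ⊢
    rw [len_add, wt_add, Finsupp.add_apply]
    omega
  · exact fun d => Submodule.inclusion_injective _
  · intro d y
    obtain ⟨q, hq, hy⟩ := exists_eq_monomial_mul y.2 (hU d)
    refine ⟨⟨q, hq⟩, Subtype.ext ?_⟩
    rw [hψ]
    exact (congrArg _ hy.symm).trans (tr_of_mem y.2)
  · intro a b hab
    refine sub_eq_zero.1 ?_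
    have h1 : ψ 0 (a - b) = 0 := by rw [map_sub, hab, sub_self]
    obtain ⟨c, hc⟩ := toric_connected e (a - b)
    rw [hc] at h1 ⊢
    have h2 : tr (U.u 0) (X * (c • 1)) = 0 := congrArg Subtype.val h1
    have h3 := congrArg (MvPolynomial.coeff x₀) h2
    rw [coeff_tr, if_pos h0] at h3
    simp only [mul_smul_comm, mul_one, MvPolynomial.coeff_smul, MvPolynomial.coeff_zero, X,
      MvPolynomial.coeff_monomial, if_true, smul_eq_mul] at h3
    rw [h3, zero_smul]
  · intro d x
    constructor
    · intro h
      have h3 : X * x.1 ∈ mon (U.u (d + 1))ᶜ := tr_eq_zero_iff.1 (congrArg Subtype.val h)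
      refine ⟨⟨x.1, fun ν hν => (hJ d ν).2 ⟨x.2 ν hν, h3 _ ?_⟩⟩, rfl⟩
      rw [MvPolynomial.mem_support_iff, MvPolynomial.coeff_monomial_mul, one_mul]
      exact MvPolynomial.mem_support_iff.1 hν
    · rintro ⟨y, rfl⟩
      refine Subtype.ext (tr_eq_zero_iff.2 (mul_mem_mon hX y.2 ?_))
      rintro _ rfl ν hν
      exact ((hJ d ν).1 hν).2

end MonMod

end Scroll

namespace Scroll

namespace MonMod

variable {e : Fin 3 → ℤ}

/-- Sections supported on the coordinate stratum `I`, with `X`-degree at most `c` above the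
bound. -/
def strat (e : Fin 3 → ℤ) (I : Finset (Fin 3)) (c : ℤ) : MonMod e where
  u d := {μ | len μ = d ∧ (μ 0 : ℤ) ≤ wt e μ + c ∧ ∀ j ∉ I, μ (Fin.succ j) = 0}
  conv {l m m' μ ν ν'} hμ hν hν' h := by
    simp only [mem_adm, Set.mem_ofPred_eq, len_add, wt_add, Finsupp.add_apply] at *
    refine ⟨by omega, by omega, fun j hj => ?_⟩
    have := h.2.2 j hj
    omega

/-- Sections on the stratum `I` attaining the bound `c` exactly. -/
def face (e : Fin 3 → ℤ) (I : Finset (Fin 3)) (c : ℤ) : MonMod e where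
  u d := {μ | len μ = d ∧ (μ 0 : ℤ) = wt e μ + c ∧ ∀ j ∉ I, μ (Fin.succ j) = 0}
  conv {l m m' μ ν ν'} hμ hν hν' h := by
    simp only [mem_adm, Set.mem_ofPred_eq, len_add, wt_add, Finsupp.add_apply] at *
    refine ⟨by omega, by omega, fun j hj => ?_⟩
    have := h.2.2 j hj
    omega

/-- Sections on the stratum `I`, in positive degrees, staying strictly below the bound. -/
def inner (e : Fin 3 → ℤ) (I : Finset (Fin 3)) : MonMod e where
  u d := {μ | len μ = d + 1 ∧ (μ 0 : ℤ) + 1 ≤ wt e μ ∧ ∀ j ∉ I, μ (Fin.succ j) = 0}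
  conv {l m m' μ ν ν'} hμ hν hν' h := by
    simp only [mem_adm, Set.mem_ofPred_eq, len_add, wt_add, Finsupp.add_apply] at *
    refine ⟨by omega, by omega, fun j hj => ?_⟩
    have := h.2.2 j hj
    omega

/-- The ideal of the stratum `I` inside the stratum `I'`. -/
def rel (e : Fin 3 → ℤ) (I I' : Finset (Fin 3)) : MonMod e where
  u d := {μ | len μ = d + 1 ∧ (μ 0 : ℤ) ≤ wt e μ ∧ (∃ j ∉ I, μ (Fin.succ j) ≠ 0) ∧
    ∀ j ∉ I', μ (Fin.succ j) = 0}
  conv {l m m' μ ν ν'} hμ hν hν' h := by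
    simp only [mem_adm, Set.mem_ofPred_eq, len_add, wt_add, Finsupp.add_apply] at *
    obtain ⟨j₀, hj₀, h₀⟩ := hμ.2.2.1
    refine ⟨by omega, by omega, ⟨j₀, hj₀, by omega⟩, fun j hj => ?_⟩
    have := h.2.2.2 j hj
    omega

/-- The annihilator of a generator of a face. -/
def ann (e : Fin 3 → ℤ) (I : Finset (Fin 3)) : MonMod e where
  u d := {μ | len μ = d + 1 ∧ (μ 0 : ℤ) ≤ wt e μ ∧
    ((μ 0 : ℤ) + 1 ≤ wt e μ ∨ ∃ j ∉ I, μ (Fin.succ j) ≠ 0)}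
  conv {l m m' μ ν ν'} hμ hν hν' h := by
    simp only [mem_adm, Set.mem_ofPred_eq, len_add, wt_add, Finsupp.add_apply] at *
    refine ⟨by omega, by omega, hμ.2.2.imp (fun _ => by omega) ?_⟩
    rintro ⟨j, hj, h'⟩
    exact ⟨j, hj, by omega⟩

/-- The exponent of a fibre coordinate. -/
abbrev W (i : Fin 3) : Fin 4 →₀ ℕ := Finsupp.single i.succ 1

theorem len_W (i : Fin 3) : len (W i) = 1 := by
  simp [len, Finsupp.single_apply]

theorem wt_W (e : Fin 3 → ℤ) (i : Fin 3) : wt e (W i) = e i - 1 := by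
  simp [wt, Finsupp.single_apply]

theorem exists_eq_W_add {μ : Fin 4 →₀ ℕ} {i : Fin 3} (h : μ i.succ ≠ 0) : ∃ ν, μ = W i + ν := by
  refine ⟨μ - W i, (add_tsub_cancel_of_le ?_).symm⟩
  rw [Finsupp.single_le_iff]
  omega

theorem W_zero (i : Fin 3) : W i 0 = 0 := by
  simp [Fin.succ_ne_zero]

theorem W_of_ne {i j : Fin 3} (h : i ≠ j) : W i j.succ = 0 := by
  simp [h]

theorem W_self (i : Fin 3) : W i i.succ = 1 := by
  simp

theorem inner_lin (he : ∀ i, 1 ≤ e i) {p : ℕ}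
    (ih : ∀ I c, 0 ≤ c → (strat e I c).toGMod.Lin p) (I : Finset (Fin 3)) :
    (inner e I).toGMod.Lin p := by
  induction I using Finset.strongInduction with
  | H I hI =>
    by_cases h : ∃ i ∈ I, e i ≠ 1
    · obtain ⟨i, hi, hei⟩ := h
      have h1 := he i
      have h1' : 1 < e i := lt_of_le_of_ne h1 (Ne.symm hei)
      refine lin_ext (W i) (U₁ := strat e I (e i - 2)) (U₂ := inner e (I.erase i))
        ?_ ?_ ?_ ?_ ?_ (ih I _ (by omega)) (hI _ (Finset.erase_ssubset hi))
      · rintro d ν ⟨h2, h3, h4⟩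
        refine ⟨by rw [len_add, len_W]; omega, ?_, fun j hj => ?_⟩
        · rw [wt_add, wt_W, Finsupp.add_apply, W_zero]; omega
        · rw [Finsupp.add_apply, h4 j hj, W_of_ne (by rintro rfl; exact hj hi)]
      · rintro d μ ⟨h2, h3, h4⟩
        exact ⟨h2, h3, fun j hj => h4 j fun h => hj (Finset.mem_of_mem_erase h)⟩
      · rintro d ν - ⟨-, -, h4⟩
        have := h4 i (Finset.notMem_erase i I)
        rw [Finsupp.add_apply, W_self] at this
        omega
      · rintro d μ ⟨h2, h3, h4⟩
        by_cases h5 : μ i.succ = 0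
        · refine Or.inl ⟨h2, h3, fun j hj => ?_⟩
          by_cases hji : j = i
          · rwa [hji]
          · exact h4 j fun h => hj (Finset.mem_erase.2 ⟨hji, h⟩)
        · obtain ⟨ν, rfl⟩ := exists_eq_W_add h5
          rw [len_add, len_W] at h2
          rw [wt_add, wt_W, Finsupp.add_apply, W_zero] at h3
          refine Or.inr ⟨ν, ⟨by omega, by omega, fun j hj => ?_⟩, rfl⟩
          have := h4 j hj
          rw [Finsupp.add_apply] at this
          omega
      · rintro l m ν ⟨h2, h3, h4⟩ α hα ⟨h5, h6, h7⟩
        rw [len_add, len_W] at h5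
        rw [wt_add, wt_W, Finsupp.add_apply, W_zero] at h6
        refine ⟨by omega, by omega, fun j hj => ?_⟩
        have := h7 j hj
        rw [Finsupp.add_apply] at this
        omega
    · push Not at h
      refine lin_of_empty ?_ p
      rintro d μ ⟨h1, h2, h3⟩
      rw [wt_eq_zero fun i hi => h i (by_contra fun h' => hi (h3 i h'))] at h2
      omega

theorem rel_lin (he : ∀ i, 1 ≤ e i) {p : ℕ}
    (ih : ∀ I c, 0 ≤ c → (strat e I c).toGMod.Lin p) (I I' : Finset (Fin 3)) (hII : I ⊆ I') :
    (rel e I I').toGMod.Lin p := by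
  induction I' using Finset.strongInduction with
  | H I' hI =>
    by_cases h : ∃ i ∈ I', i ∉ I
    · obtain ⟨i, hi, hei⟩ := h
      have h1 := he i
      refine lin_ext (W i) (U₁ := strat e I' (e i - 1)) (U₂ := rel e I (I'.erase i))
        ?_ ?_ ?_ ?_ ?_ (ih I' _ (by omega)) (hI _ (Finset.erase_ssubset hi)
          (Finset.subset_erase.2 ⟨hII, hei⟩))
      · rintro d ν ⟨h2, h3, h4⟩
        refine ⟨by rw [len_add, len_W]; omega, ?_, ⟨i, hei, ?_⟩, fun j hj => ?_⟩
        · rw [wt_add, wt_W, Finsupp.add_apply, W_zero]; omega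
        · rw [Finsupp.add_apply, W_self]; omega
        · rw [Finsupp.add_apply, h4 j hj, W_of_ne (by rintro rfl; exact hj hi)]
      · rintro d μ ⟨h2, h3, h3', h4⟩
        exact ⟨h2, h3, h3', fun j hj => h4 j fun h => hj (Finset.mem_of_mem_erase h)⟩
      · rintro d ν - ⟨-, -, -, h4⟩
        have := h4 i (Finset.notMem_erase i I')
        rw [Finsupp.add_apply, W_self] at this
        omega
      · rintro d μ ⟨h2, h3, h3', h4⟩
        by_cases h5 : μ i.succ = 0
        · refine Or.inl ⟨h2, h3, h3', fun j hj => ?_⟩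
          by_cases hji : j = i
          · rwa [hji]
          · exact h4 j fun h => hj (Finset.mem_erase.2 ⟨hji, h⟩)
        · obtain ⟨ν, rfl⟩ := exists_eq_W_add h5
          rw [len_add, len_W] at h2
          rw [wt_add, wt_W, Finsupp.add_apply, W_zero] at h3
          refine Or.inr ⟨ν, ⟨by omega, by omega, fun j hj => ?_⟩, rfl⟩
          have := h4 j hj
          rw [Finsupp.add_apply] at this
          omega
      · rintro l m ν ⟨h2, h3, h4⟩ α hα ⟨h5, h6, -, h7⟩
        rw [len_add, len_W] at h5
        rw [wt_add, wt_W, Finsupp.add_apply, W_zero] at h6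
        refine ⟨by omega, by omega, fun j hj => ?_⟩
        have := h7 j hj
        rw [Finsupp.add_apply] at this
        omega
    · push Not at h
      refine lin_of_empty ?_ p
      rintro d μ ⟨-, -, ⟨j, hj, hj'⟩, h3⟩
      exact hj' (h3 j fun h' => hj (h j h'))

theorem ann_lin (he : ∀ i, 1 ≤ e i) {p : ℕ}
    (ih : ∀ I c, 0 ≤ c → (strat e I c).toGMod.Lin p) (I : Finset (Fin 3)) :
    (ann e I).toGMod.Lin p := by
  refine lin_ext 0 (U₁ := rel e I Finset.univ) (U₂ := inner e I)
    ?_ ?_ ?_ ?_ ?_ (rel_lin he ih _ _ (Finset.subset_univ I)) (inner_lin he ih I)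
  · rintro d ν ⟨h1, h2, h3, -⟩
    rw [zero_add]
    exact ⟨h1, h2, Or.inr h3⟩
  · rintro d μ ⟨h1, h2, h3⟩
    exact ⟨h1, by omega, Or.inl h2⟩
  · rintro d ν ⟨-, -, ⟨j, hj, hj'⟩, -⟩ ⟨-, -, h⟩
    rw [zero_add] at h
    exact hj' (h j hj)
  · rintro d μ ⟨h1, h2, h3⟩
    by_cases h : ∃ j ∉ I, μ (Fin.succ j) ≠ 0
    · exact Or.inr ⟨μ, ⟨h1, h2, h, by simp⟩, (zero_add μ).symm⟩
    · have h4 := h3.resolve_right h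
      push Not at h
      exact Or.inl ⟨h1, h4, h⟩
  · rintro l m ν ⟨h1, h2, ⟨j, hj, hj'⟩, -⟩ α hα -
    rw [mem_adm] at hα
    refine ⟨by rw [len_add]; omega, ?_, ⟨j, hj, ?_⟩, by simp⟩
    · rw [wt_add, Finsupp.add_apply]; omega
    · rw [Finsupp.add_apply]; omega

theorem strat_lin (he : ∀ i, 1 ≤ e i) (p : ℕ) (I : Finset (Fin 3)) (c : ℤ) (hc : 0 ≤ c) :
    (strat e I c).toGMod.Lin p := by
  induction p generalizing I c with
  | zero => trivial
  | succ p ih =>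
    lift c to ℕ using hc
    induction c with
    | zero =>
      refine lin_cyclic (J := rel e I Finset.univ) 0 ?_ ?_ ?_
        (rel_lin he ih _ _ (Finset.subset_univ I))
      · simp [strat, len, wt]
      · rintro d μ ⟨h1, h2, -⟩
        exact ⟨μ, mem_adm.2 ⟨h1, by simpa using h2⟩, (zero_add μ).symm⟩
      · intro d ν
        simp only [strat, rel, mem_adm, zero_add, Set.mem_ofPred_eq]
        constructor
        · rintro ⟨h1, h2, ⟨j, hj, hj'⟩, -⟩
          exact ⟨⟨h1, h2⟩, fun h => hj' (h.2.2 j hj)⟩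
        · rintro ⟨⟨h1, h2⟩, h3⟩
          refine ⟨h1, h2, ?_, by simp⟩
          by_contra h
          push Not at h
          exact h3 ⟨h1, by simpa using h2, h⟩
    | succ c ihc =>
      have hX0 : (Finsupp.single (0 : Fin 4) (c + 1) : Fin 4 →₀ ℕ) 0 = c + 1 := by simp
      have hXs (j : Fin 3) : (Finsupp.single (0 : Fin 4) (c + 1) : Fin 4 →₀ ℕ) j.succ = 0 := by
        simp
      set X : Fin 4 →₀ ℕ := Finsupp.single (0 : Fin 4) (c + 1) with hX
      have hXl : len X = 0 := Finset.sum_eq_zero fun i _ => hXs i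
      have hXw : wt e X = 0 := wt_eq_zero fun i hi => absurd (hXs i) hi
      have hface : (face e I (c + 1 : ℕ)).toGMod.Lin (p + 1) := by
        refine lin_cyclic (J := ann e I) X ?_ ?_ ?_ (ann_lin he ih I)
        · exact ⟨hXl, by rw [hX0, hXw]; push_cast; ring, fun j _ => hXs j⟩
        · rintro d μ ⟨h1, h2, h3⟩
          have h4 : 0 ≤ wt e μ := by
            refine Finset.sum_nonneg fun i _ => mul_nonneg (by positivity) ?_
            have := he i
            omega
          have h5 : X ≤ μ := by
            rw [hX, Finsupp.single_le_iff]
            omega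
          obtain ⟨ν, rfl⟩ := exists_add_of_le h5
          rw [len_add, hXl] at h1
          rw [wt_add, hXw, Finsupp.add_apply, hX0] at h2
          exact ⟨ν, mem_adm.2 ⟨by omega, by push_cast at h2; omega⟩, rfl⟩
        · intro d ν
          simp only [face, ann, mem_adm, Set.mem_ofPred_eq, len_add, wt_add, Finsupp.add_apply,
            hXl, hXw, hX0, hXs, zero_add]
          push_cast
          constructor
          · rintro ⟨h1, h2, h3⟩
            refine ⟨⟨h1, h2⟩, fun h => ?_⟩
            rcases h3 with h3 | ⟨j, hj, hj'⟩
            · omega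
            · exact hj' (h.2.2 j hj)
          · rintro ⟨⟨h1, h2⟩, h3⟩
            refine ⟨h1, h2, ?_⟩
            by_contra h
            push Not at h
            exact h3 ⟨h1, by omega, h.2⟩
      refine lin_ext 0 (U₁ := strat e I c) (U₂ := face e I (c + 1 : ℕ)) ?_ ?_ ?_ ?_ ?_ ihc hface
      · rintro d ν ⟨h1, h2, h3⟩
        rw [zero_add]
        exact ⟨h1, by push_cast; omega, h3⟩
      · rintro d μ ⟨h1, h2, h3⟩
        exact ⟨h1, h2.le, h3⟩
      · rintro d ν ⟨-, h2, -⟩ ⟨-, h4, -⟩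
        rw [zero_add] at h4
        push_cast at h4
        omega
      · rintro d μ ⟨h1, h2, h3⟩
        by_cases h : (μ 0 : ℤ) = wt e μ + (c + 1 : ℕ)
        · exact Or.inl ⟨h1, h, h3⟩
        · refine Or.inr ⟨μ, ⟨h1, ?_, h3⟩, (zero_add μ).symm⟩
          push_cast at h h2
          omega
      · rintro l m ν ⟨h1, h2, h3⟩ α hα ⟨h4, h5, h6⟩
        rw [mem_adm] at hα
        rw [zero_add] at h4 h6
        refine ⟨h4, ?_, h6⟩
        rw [wt_add, Finsupp.add_apply]
        omega

/-- The toric algebra of the scroll is Koszul. -/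
theorem toric_plus_lin (he : ∀ i, 1 ≤ e i) (p : ℕ) : (GMod.plus (toric e).ring).Lin p := by
  have hset (d : ℕ) : (rel e ∅ Finset.univ).u d = adm e (d + 1) := by
    ext μ
    rw [mem_adm]
    refine ⟨fun h => ⟨h.1, h.2.1⟩, fun h => ⟨h.1, h.2, ?_, by simp⟩⟩
    by_contra h'
    push Not at h'
    have : len μ = 0 := Finset.sum_eq_zero fun i _ => h' i (Finset.notMem_empty i)
    omega
  have hle (d : ℕ) : mon ((rel e ∅ Finset.univ).u d) = (toric e).piece (d + 1) :=
    congrArg mon (hset d)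
  refine GMod.Lin.of_bijective (N := (rel e ∅ Finset.univ).toGMod)
    ⟨fun d => (LinearEquiv.ofEq _ _ (hle d)).toLinearMap, ?_⟩
    (fun d => (LinearEquiv.ofEq _ _ (hle d)).bijective)
    (rel_lin he (fun I c hc => strat_lin he p I c hc) _ _ (Finset.subset_univ _))
  intro l m n h x a
  refine Subtype.ext (tr_of_mem ?_)
  rw [hle]
  exact (toric e).ring.mul (show l + 1 + m = n + 1 by omega) ⟨x.1, hle l ▸ x.2⟩ a |>.2

end MonMod

end Scroll

namespace GRing

variable {k : Type} [Field k]

/-- A two-sided homogeneous ideal. -/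
structure GIdeal (S : GRing k) where
  I : ∀ n, Submodule k (S.R n)
  left : ∀ {l m n : ℕ} (h : l + m = n) {a : S.R l} (b : S.R m), a ∈ I l → S.mul h a b ∈ I n
  right : ∀ {l m n : ℕ} (h : l + m = n) (a : S.R l) {b : S.R m}, b ∈ I m → S.mul h a b ∈ I n

/-- The quotient of a graded algebra by a homogeneous ideal. -/
abbrev quot (S : GRing k) (J : S.GIdeal) : GRing k where
  R n := S.R n ⧸ J.I n
  one := (J.I 0).mkQ S.one
  mul {l m n} h := ((J.I m).liftQ ((J.I l).liftQ ((S.mul h).compr₂ (J.I n).mkQ) (by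
      intro a ha
      refine LinearMap.ext fun b => ?_
      exact (Submodule.Quotient.mk_eq_zero _).2 (J.left h b ha))).flip (by
    intro b hb
    refine LinearMap.ext fun a => ?_
    obtain ⟨a, rfl⟩ := Submodule.mkQ_surjective _ a
    exact (Submodule.Quotient.mk_eq_zero _).2 (J.right h a hb))).flip
  one_mul' h a := by
    obtain ⟨a, rfl⟩ := Submodule.mkQ_surjective _ a
    exact congrArg _ (S.one_mul' h a)
  mul_one' h a := by
    obtain ⟨a, rfl⟩ := Submodule.mkQ_surjective _ a
    exact congrArg _ (S.mul_one' h a)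
  assoc h₁ h₂ h₃ h₄ a b c := by
    obtain ⟨a, rfl⟩ := Submodule.mkQ_surjective _ a
    obtain ⟨b, rfl⟩ := Submodule.mkQ_surjective _ b
    obtain ⟨c, rfl⟩ := Submodule.mkQ_surjective _ c
    exact congrArg _ (S.assoc h₁ h₂ h₃ h₄ a b c)

/-- The projection to a quotient. -/
def toQuot (S : GRing k) (J : S.GIdeal) : GRing.Hom S (S.quot J) where
  f n := (J.I n).mkQ
  map_one := rfl
  map_mul _ _ _ := rfl

end GRing

namespace Scroll

open MvPolynomial

theorem mul_mem_AdmSub_toric {e : Fin 3 → ℤ} {l m n : ℕ} {r s : ℤ} {p q : MvPolynomial (Fin 4) ℂ}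
    (h : l + m = n) (hp : p ∈ AdmSub e l r) (hq : q ∈ AdmSub e m m) (hs : s = r + m) :
    p * q ∈ AdmSub e n s :=
  AdmSub_mul_mem hp hq h hs.le

/-- The degree-`n` component of the ideal of the hypersurface `Q = 0` in the toric algebra. -/
def hyp (e : Fin 3 → ℤ) (Q : MvPolynomial (Fin 4) ℂ) (a : ℤ) :
    ℕ → Submodule ℂ (MvPolynomial (Fin 4) ℂ)
  | 0 => ⊥
  | 1 => ⊥
  | n + 2 => Submodule.map (LinearMap.mulLeft ℂ Q) (AdmSub e n (n + 2 - a))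

theorem hyp_mul_mem {e : Fin 3 → ℤ} {Q : MvPolynomial (Fin 4) ℂ} {a : ℤ} {l m n : ℕ}
    {p q : MvPolynomial (Fin 4) ℂ} (h : l + m = n) (hp : p ∈ hyp e Q a l)
    (hq : q ∈ AdmSub e m m) : p * q ∈ hyp e Q a n := by
  match l, hp with
  | 0, hp => rw [(Submodule.mem_bot ℂ).1 hp, zero_mul]; exact zero_mem _
  | 1, hp => rw [(Submodule.mem_bot ℂ).1 hp, zero_mul]; exact zero_mem _
  | l + 2, hp =>
    obtain ⟨c, hc, rfl⟩ := hp
    obtain ⟨n, rfl⟩ : ∃ r, n = r + 2 := ⟨n - 2, by omega⟩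
    refine ⟨c * q, mul_mem_AdmSub_toric (by omega) hc hq ?_, (mul_assoc _ _ _).symm⟩
    have : (l : ℤ) + m = n := by omega
    omega

/-- The homogeneous ideal of a hypersurface in the toric algebra. -/
def hypIdeal (e : Fin 3 → ℤ) (Q : MvPolynomial (Fin 4) ℂ) (a : ℤ) :
    (toric e).ring.GIdeal where
  I n := (hyp e Q a n).comap ((toric e).piece n).subtype
  left h _ b ha := hyp_mul_mem h ha b.2
  right {l m n} h f b hb := by
    change f.1 * b.1 ∈ hyp e Q a n
    rw [mul_comm]
    exact hyp_mul_mem (by omega) hb f.2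

theorem AdmSub_eq_mon_strat {e : Fin 3 → ℤ} {a : ℤ} {d : ℕ} :
    AdmSub e d (d + 2 - a) = mon ((MonMod.strat e Finset.univ (a - 2)).u d) := by
  have : {μ | admissible e d (d + 2 - a) μ} = (MonMod.strat e Finset.univ (a - 2)).u d := by
    ext μ
    refine admissible_iff.trans ?_
    simp only [MonMod.strat, Set.mem_ofPred_eq, Finset.mem_univ, not_true, false_implies,
      implies_true, and_true]
    omega
  exact congrArg mon this

/-- The coordinate algebra of a hypersurface of type `O(2)(-aH)` is Koszul. -/
theorem hyp_plus_lin {e : Fin 3 → ℤ} (he : ∀ i, 1 ≤ e i) {Q : MvPolynomial (Fin 4) ℂ} {a : ℤ}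
    (ha : 2 ≤ a) (hQ : Q ∈ AdmSub e 2 a) (hQ0 : Q ≠ 0) (p : ℕ) :
    (GMod.plus ((toric e).ring.quot (hypIdeal e Q a))).Lin p := by
  let M := (MonMod.strat e Finset.univ (a - 2)).toGMod
  have hM (d) (x : M.N d) : x.1 ∈ AdmSub e d (d + 2 - a) := AdmSub_eq_mon_strat.ge x.2
  have hmem (d) (x : M.N d) : Q * x.1 ∈ (toric e).piece (d + 2) :=
    AdmSub_mul_mem hQ (hM d x) (by omega) (by push_cast; omega)
  let ι (d : ℕ) : M.N d →ₗ[ℂ] (toric e).ring.R (d + 2) :=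
    (LinearMap.mulLeft ℂ Q ∘ₗ (mon _).subtype).codRestrict _ (hmem d)
  refine GMod.Lin.plus_descend ((toric e).ring.toQuot _) (fun d => Submodule.mkQ_surjective _) ?_
    M ι ?_ ?_ ?_ (fun p => MonMod.strat_lin he p _ _ (by omega)) (MonMod.toric_plus_lin he) p
  · intro x y hxy
    rw [← sub_eq_zero, ← map_sub] at hxy
    have := (Submodule.Quotient.mk_eq_zero _).1 hxy
    exact sub_eq_zero.1 (Subtype.ext ((Submodule.mem_bot ℂ).1 this))
  · intro l m n h h' x b
    refine Subtype.ext ?_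
    change Q * tr _ (x.1 * b.1) = Q * x.1 * b.1
    rw [mul_assoc, tr_of_mem]
    refine AdmSub_eq_mon_strat.le (mul_mem_AdmSub_toric h (hM l x) b.2 ?_)
    have : (l : ℤ) + m = n := by omega
    omega
  · intro d x y hxy
    exact Subtype.ext (mul_left_cancel₀ hQ0 (congrArg Subtype.val hxy))
  · intro d x
    refine (Submodule.Quotient.mk_eq_zero _).trans ?_
    constructor
    · rintro ⟨c, hc, hx⟩
      exact ⟨⟨c, AdmSub_eq_mon_strat.le hc⟩, Subtype.ext hx⟩
    · rintro ⟨c, rfl⟩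
      exact ⟨c.1, hM d c, rfl⟩

/-- Koszulness of the coordinate algebra of the intersection of a hypersurface with a
quadric. -/
theorem isKoszul_of_complete_intersection {F : Type} [Field F] [Algebra ℂ F]
    (R : GradedSystem ℂ F) (hR : R.ConnectedOne) [FiniteDimensional ℂ (R.piece 1)]
    {e : Fin 3 → ℤ} (he : ∀ i, 1 ≤ e i) {Q₁ Q₂ : MvPolynomial (Fin 4) ℂ} {a : ℤ} (ha : 2 ≤ a)
    (hQ₁ : Q₁ ∈ AdmSub e 2 a) (hQ₁0 : Q₁ ≠ 0) (hQ₂ : Q₂ ∈ AdmSub e 2 2)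
    (ev : MvPolynomial (Fin 4) ℂ →ₐ[ℂ] F)
    (hev : ∀ n, ∀ p ∈ AdmSub e n n, ev p ∈ R.piece n)
    (hsurj : ∀ n, ∀ f ∈ R.piece n, ∃ p ∈ AdmSub e n n, ev p = f)
    (hinj : ∀ p ∈ AdmSub e 1 1, ev p = 0 → p = 0)
    (hev₁ : ev Q₁ = 0) (hev₂ : ev Q₂ = 0)
    (hker : ∀ n : ℕ, ∀ p ∈ AdmSub e (n + 2) (n + 2), ev p = 0 →
      ∃ A ∈ AdmSub e n (n + 2 - a), ∃ B ∈ AdmSub e n n, p = Q₁ * A + Q₂ * B)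
    (hsyz : ∀ n : ℕ, ∀ A ∈ AdmSub e n (n + 2 - a), ∀ B ∈ AdmSub e n n,
      Q₁ * A + Q₂ * B = 0 → B ∈ hyp e Q₁ a n) : R.IsKoszul := by
  refine R.isKoszul_of_lin hR fun p => ?_
  let S := (toric e).ring.quot (hypIdeal e Q₁ a)
  have hhyp (n : ℕ) (p) (hp : p ∈ hyp e Q₁ a n) : ev p = 0 := by
    match n, hp with
    | 0, hp => rw [(Submodule.mem_bot ℂ).1 hp, map_zero]
    | 1, hp => rw [(Submodule.mem_bot ℂ).1 hp, map_zero]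
    | n + 2, hp =>
      obtain ⟨c, -, rfl⟩ := hp
      rw [LinearMap.mulLeft_apply, map_mul, hev₁, zero_mul]
  let E (n : ℕ) : (toric e).piece n →ₗ[ℂ] R.piece n :=
    ev.toLinearMap.restrict fun p hp => hev n p hp
  let π : GRing.Hom S R.ring :=
    { f := fun n => ((hypIdeal e Q₁ a).I n).liftQ (E n) fun p hp => Subtype.ext (hhyp n _ hp)
      map_one := Subtype.ext (map_one ev)
      map_mul := by
        intro l m n h x y
        obtain ⟨x, rfl⟩ := Submodule.mkQ_surjective _ x
        obtain ⟨y, rfl⟩ := Submodule.mkQ_surjective _ y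
        exact Subtype.ext (map_mul ev x.1 y.1) }
  have hmul (d) (x : (toric e).piece d) : Q₂ * x.1 ∈ (toric e).piece (d + 2) :=
    AdmSub_mul_mem hQ₂ x.2 (by omega) (by push_cast; omega)
  let μ (d : ℕ) : (toric e).piece d →ₗ[ℂ] (toric e).piece (d + 2) :=
    (LinearMap.mulLeft ℂ Q₂ ∘ₗ ((toric e).piece d).subtype).codRestrict _ (hmul d)
  let ι (d : ℕ) : S.R d →ₗ[ℂ] S.R (d + 2) :=
    ((hypIdeal e Q₁ a).I d).mapQ ((hypIdeal e Q₁ a).I (d + 2)) (μ d) fun x hx => by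
      change Q₂ * x.1 ∈ hyp e Q₁ a (d + 2)
      rw [mul_comm]
      exact hyp_mul_mem rfl hx hQ₂
  have hSconn : S.Connected := by
    intro x
    obtain ⟨x, rfl⟩ := Submodule.mkQ_surjective _ x
    obtain ⟨c, rfl⟩ := toric_connected e x
    exact ⟨c, map_smul _ _ _⟩
  refine GMod.Lin.plus_descend π ?_ ?_ (GMod.self S) ι ?_ ?_ ?_ (GMod.Lin.self hSconn)
    (hyp_plus_lin he ha hQ₁ hQ₁0) p
  · rintro d ⟨f, hf⟩
    obtain ⟨p, hp, rfl⟩ := hsurj d f hf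
    exact ⟨Submodule.Quotient.mk ⟨p, hp⟩, rfl⟩
  · rw [injective_iff_map_eq_zero]
    intro x hx
    obtain ⟨x, rfl⟩ := Submodule.mkQ_surjective _ x
    have : x = 0 := Subtype.ext (hinj x.1 x.2 (congrArg Subtype.val hx))
    rw [this, map_zero]
  · intro l m n h h' x y
    obtain ⟨x, rfl⟩ := Submodule.mkQ_surjective _ x
    obtain ⟨y, rfl⟩ := Submodule.mkQ_surjective _ y
    exact congrArg ((hypIdeal e Q₁ a).I (n + 2)).mkQ (Subtype.ext (mul_assoc Q₂ x.1 y.1).symm)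
  · intro d
    rw [injective_iff_map_eq_zero]
    intro x hx
    obtain ⟨x, rfl⟩ := Submodule.mkQ_surjective _ x
    obtain ⟨c, hc, hx⟩ := (Submodule.Quotient.mk_eq_zero _).1 hx
    refine (Submodule.Quotient.mk_eq_zero _).2 (hsyz d (-c) (neg_mem hc) x.1 x.2 ?_)
    rw [mul_neg, neg_add_eq_zero]
    exact hx
  · intro d x
    obtain ⟨x, rfl⟩ := Submodule.mkQ_surjective _ x
    constructor
    · intro hx
      obtain ⟨A, hA, B, hB, h⟩ := hker d x.1 x.2 (congrArg Subtype.val hx)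
      refine ⟨Submodule.Quotient.mk ⟨B, hB⟩, ?_⟩
      refine (Submodule.Quotient.eq _).2 ⟨-A, neg_mem hA, ?_⟩
      change Q₁ * -A = Q₂ * B - x.1
      rw [h]
      ring
    · rintro ⟨y, hy⟩
      obtain ⟨y, rfl⟩ := Submodule.mkQ_surjective _ y
      rw [← hy]
      refine Subtype.ext ?_
      change ev (Q₂ * y.1) = 0
      rw [map_mul, hev₂, zero_mul]

end Scroll

/-! ### Dimensions of the spaces of sections on the scroll -/

namespace Scroll

open MvPolynomial

theorem finrank_mon (s : Set (Fin 4 →₀ ℕ)) : Module.finrank ℂ (mon s) = s.ncard :=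
  Module.finrank_eq_nat_card_basis (MvPolynomial.basisRestrictSupport ℂ s)

theorem finiteDimensional_mon {s : Set (Fin 4 →₀ ℕ)} (hs : s.Finite) :
    FiniteDimensional ℂ (mon s) :=
  have := hs.to_subtype
  Module.Basis.finiteDimensional_of_finite (MvPolynomial.basisRestrictSupport ℂ s)

/-- The exponents of a monomial with `j`, `N - j`, `n - N` as fibre exponents. -/
def expo (n : ℕ) (t : Σ _ : ℕ, Σ _ : ℕ, ℕ) : Fin 4 →₀ ℕ :=
  Finsupp.equivFunOnFinite.symm ![t.2.2, t.1 - t.2.1, t.2.1, n - t.1]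

/-- The parameters of the admissible monomials of bidegree `(n, m)`. -/
def expoSet (e : Fin 3 → ℤ) (n : ℕ) (m : ℤ) : Finset (Σ _ : ℕ, Σ _ : ℕ, ℕ) :=
  (Finset.range (n + 1)).sigma fun N => (Finset.range (N + 1)).sigma fun j =>
    Finset.range ((N - j : ℤ) * e 0 + j * e 1 + (n - N) * e 2 - m + 1).toNat

theorem mem_expoSet {e : Fin 3 → ℤ} {n : ℕ} {m : ℤ} {N j x : ℕ} :
    (⟨N, j, x⟩ : Σ _ : ℕ, Σ _ : ℕ, ℕ) ∈ expoSet e n m ↔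
      N ≤ n ∧ j ≤ N ∧ x + m ≤ (N - j : ℤ) * e 0 + j * e 1 + (n - N) * e 2 := by
  simp only [expoSet, Finset.mem_sigma, Finset.mem_range]
  omega

theorem admissible_expo {e : Fin 3 → ℤ} {n : ℕ} {m : ℤ} {N j x : ℕ} (hN : N ≤ n) (hj : j ≤ N) :
    admissible e n m (expo n ⟨N, j, x⟩) ↔
      x + m ≤ (N - j : ℤ) * e 0 + j * e 1 + (n - N) * e 2 := by
  have h1 : N - j + j + (n - N) = n := by omega
  simp [admissible, expo, Fin.sum_univ_three, h1, Nat.cast_sub hN, Nat.cast_sub hj]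

theorem setOf_admissible (e : Fin 3 → ℤ) (n : ℕ) (m : ℤ) :
    {μ | admissible e n m μ} = expo n '' (expoSet e n m) := by
  ext μ
  constructor
  · intro h
    have hn : μ 1 + μ 2 + μ 3 = n := by simpa [Fin.sum_univ_three] using h.1
    have hμ : expo n ⟨μ 1 + μ 2, μ 2, μ 0⟩ = μ := by
      ext i
      fin_cases i
      · rfl
      · change μ 1 + μ 2 - μ 2 = μ 1
        omega
      · rfl
      · change n - (μ 1 + μ 2) = μ 3
        omega
    refine ⟨⟨μ 1 + μ 2, μ 2, μ 0⟩, Finset.mem_coe.2 (mem_expoSet.2 ⟨by omega, by omega, ?_⟩), hμ⟩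
    have h' : admissible e n m μ := h
    rw [← hμ, admissible_expo (by omega) (by omega)] at h'
    exact h'
  · rintro ⟨⟨N, j, x⟩, h, rfl⟩
    obtain ⟨hN, hj, h⟩ := mem_expoSet.1 (Finset.mem_coe.1 h)
    exact (admissible_expo hN hj).2 h

theorem injOn_expo (e : Fin 3 → ℤ) (n : ℕ) (m : ℤ) : Set.InjOn (expo n) (expoSet e n m) := by
  rintro ⟨N, j, x⟩ h ⟨N', j', x'⟩ h' heq
  obtain ⟨hN, hj, -⟩ := mem_expoSet.1 (Finset.mem_coe.1 h)
  obtain ⟨hN', hj', -⟩ := mem_expoSet.1 (Finset.mem_coe.1 h')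
  have h0 : x = x' := DFunLike.congr_fun heq 0
  have h2 : j = j' := DFunLike.congr_fun heq 2
  have h3 : n - N = n - N' := DFunLike.congr_fun heq 3
  obtain rfl : N = N' := by omega
  rw [h0, h2]

instance (e : Fin 3 → ℤ) (n : ℕ) (m : ℤ) : FiniteDimensional ℂ (AdmSub e n m) :=
  finiteDimensional_mon (s := {μ | admissible e n m μ})
    (by rw [setOf_admissible]; exact (Finset.finite_toSet _).image _)

theorem finrank_AdmSub (e : Fin 3 → ℤ) (n : ℕ) (m : ℤ) :
    Module.finrank ℂ (AdmSub e n m) = ∑ N ∈ Finset.range (n + 1), ∑ j ∈ Finset.range (N + 1),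
      ((N - j : ℤ) * e 0 + j * e 1 + (n - N) * e 2 - m + 1).toNat := by
  refine (finrank_mon {μ | admissible e n m μ}).trans ?_
  rw [setOf_admissible, (injOn_expo e n m).ncard_image, Set.ncard_coe_finset,
    expoSet, Finset.card_sigma]
  refine Finset.sum_congr rfl fun N _ => ?_
  rw [Finset.card_sigma]
  exact Finset.sum_congr rfl fun j _ => Finset.card_range _

theorem sum_range_affine (α β : ℤ) (N : ℕ) :
    2 * ∑ j ∈ Finset.range (N + 1), (α + β * j) = (N + 1) * (2 * α + β * N) := by
  induction N with
  | zero => simp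
  | succ N ih =>
    rw [Finset.sum_range_succ, mul_add, ih]
    push_cast
    ring

theorem sum_range_quadratic (α β γ : ℤ) (n : ℕ) :
    6 * ∑ N ∈ Finset.range (n + 1), (α + β * N + γ * N ^ 2) =
      (n + 1) * (6 * α + 3 * β * n + γ * n * (2 * n + 1)) := by
  induction n with
  | zero => simp
  | succ n ih =>
    rw [Finset.sum_range_succ, mul_add, ih]
    push_cast
    ring

/-- The dimension of `H⁰(X, O(n)(-mH))` when there is no higher cohomology. -/
theorem six_mul_finrank_AdmSub {e : Fin 3 → ℤ} {n : ℕ} {m c : ℤ} (he : ∀ i, c ≤ e i)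
    (hm : m ≤ c * n + 1) :
    6 * (Module.finrank ℂ (AdmSub e n m) : ℤ) =
      3 * (1 - m) * (n + 2) * (n + 1) + (e 0 + e 1 + e 2) * (n + 2) * (n + 1) * n := by
  have key : (Module.finrank ℂ (AdmSub e n m) : ℤ) = ∑ N ∈ Finset.range (n + 1),
      ∑ j ∈ Finset.range (N + 1),
        ((N * e 0 + (n - N) * e 2 - m + 1) + (e 1 - e 0) * j) := by
    rw [finrank_AdmSub, Nat.cast_sum]
    refine Finset.sum_congr rfl fun N hN => ?_
    rw [Nat.cast_sum]
    refine Finset.sum_congr rfl fun j hj => ?_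
    have hN : (N : ℤ) ≤ n := by exact_mod_cast Finset.mem_range_succ_iff.1 hN
    have hj : (j : ℤ) ≤ N := by exact_mod_cast Finset.mem_range_succ_iff.1 hj
    rw [Int.toNat_of_nonneg]
    · ring
    · nlinarith [mul_le_mul_of_nonneg_left (he 0) (sub_nonneg.2 hj),
        mul_le_mul_of_nonneg_left (he 1) (Nat.cast_nonneg (α := ℤ) j),
        mul_le_mul_of_nonneg_left (he 2) (sub_nonneg.2 hN)]
  have key2 : 2 * (Module.finrank ℂ (AdmSub e n m) : ℤ) = ∑ N ∈ Finset.range (n + 1),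
      (2 * (n * e 2 - m + 1) + (2 * (n * e 2 - m + 1) + e 0 + e 1 - 2 * e 2) * N +
        (e 0 + e 1 - 2 * e 2) * N ^ 2) := by
    rw [key, Finset.mul_sum]
    refine Finset.sum_congr rfl fun N _ => ?_
    rw [sum_range_affine]
    ring
  have := congrArg (fun t => 6 * t) key2
  simp only [sum_range_quadratic] at this
  linarith

theorem finrank_add_finrank_range_le {V W Z : Type} [AddCommGroup V] [Module ℂ V]
    [AddCommGroup W] [Module ℂ W] [AddCommGroup Z] [Module ℂ Z] [FiniteDimensional ℂ W]
    {Ψ : V →ₗ[ℂ] W} {Φ : W →ₗ[ℂ] Z} (hΨ : Injective Ψ) (h : ∀ v, Φ (Ψ v) = 0) :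
    Module.finrank ℂ V + Module.finrank ℂ (LinearMap.range Φ) ≤ Module.finrank ℂ W := by
  have hle : LinearMap.range Ψ ≤ LinearMap.ker Φ := by
    rintro _ ⟨v, rfl⟩
    exact h v
  have := Submodule.finrank_mono hle
  rw [LinearMap.finrank_range_of_inj hΨ] at this
  have := LinearMap.finrank_range_add_finrank_ker Φ
  omega

theorem exists_of_finrank_eq {V W Z : Type} [AddCommGroup V] [Module ℂ V]
    [AddCommGroup W] [Module ℂ W] [AddCommGroup Z] [Module ℂ Z] [FiniteDimensional ℂ W]
    {Ψ : V →ₗ[ℂ] W} {Φ : W →ₗ[ℂ] Z} (hΨ : Injective Ψ) (h : ∀ v, Φ (Ψ v) = 0)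
    (hd : Module.finrank ℂ V + Module.finrank ℂ (LinearMap.range Φ) = Module.finrank ℂ W)
    {w : W} (hw : Φ w = 0) : ∃ v, Ψ v = w := by
  have hle : LinearMap.range Ψ ≤ LinearMap.ker Φ := by
    rintro _ ⟨v, rfl⟩
    exact h v
  have := LinearMap.finrank_range_add_finrank_ker Φ
  have heq := Submodule.eq_of_le_of_finrank_eq hle (by
    rw [LinearMap.finrank_range_of_inj hΨ]
    omega)
  exact heq.ge hw

/-- Euler characteristic count for a complete intersection: if two equations generate the kernel
of a map with the expected dimensions, then the map is surjective and all syzygies are trivial. -/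
theorem surjective_and_syzygy {F : Type} [Field F] [Algebra ℂ F]
    (ev : MvPolynomial (Fin 4) ℂ →ₗ[ℂ] F) (Q₁ Q₂ : MvPolynomial (Fin 4) ℂ)
    (M U₁ U₂ U₁₂ : Submodule ℂ (MvPolynomial (Fin 4) ℂ)) (H : Submodule ℂ F)
    [FiniteDimensional ℂ M] [FiniteDimensional ℂ U₁] [FiniteDimensional ℂ U₂]
    [FiniteDimensional ℂ H] (hev : ∀ p ∈ M, ev p ∈ H)
    (hker : M ⊓ LinearMap.ker ev =
      Submodule.map (LinearMap.mulLeft ℂ Q₁) U₁ ⊔ Submodule.map (LinearMap.mulLeft ℂ Q₂) U₂)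
    (h₁ : ∀ p ∈ U₁₂, Q₂ * p ∈ U₁) (h₂ : ∀ p ∈ U₁₂, Q₁ * p ∈ U₂)
    (hinj : ∀ p ∈ U₁₂, Q₂ * p = 0 → p = 0)
    (hdim : Module.finrank ℂ M + Module.finrank ℂ U₁₂ =
      Module.finrank ℂ U₁ + Module.finrank ℂ U₂ + Module.finrank ℂ H) :
    (∀ f ∈ H, ∃ p ∈ M, ev p = f) ∧
    ∀ A ∈ U₁, ∀ B ∈ U₂, Q₁ * A + Q₂ * B = 0 → ∃ D ∈ U₁₂, A = Q₂ * D ∧ B = -(Q₁ * D) := by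
  let E : M →ₗ[ℂ] H := ev.restrict hev
  let Φ : U₁ × U₂ →ₗ[ℂ] MvPolynomial (Fin 4) ℂ :=
    (LinearMap.mulLeft ℂ Q₁ ∘ₗ U₁.subtype).coprod (LinearMap.mulLeft ℂ Q₂ ∘ₗ U₂.subtype)
  have hΦ (z : U₁ × U₂) : Φ z = Q₁ * z.1.1 + Q₂ * z.2.1 := rfl
  let Ψ : U₁₂ →ₗ[ℂ] U₁ × U₂ :=
    ((LinearMap.mulLeft ℂ Q₂).restrict h₁).prod (-(LinearMap.mulLeft ℂ Q₁).restrict h₂)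
  have hΨ (p : U₁₂) : Φ (Ψ p) = 0 := by
    rw [hΦ]
    change Q₁ * (Q₂ * p.1) + Q₂ * -(Q₁ * p.1) = 0
    ring
  have hΨinj : Injective Ψ := by
    rw [injective_iff_map_eq_zero]
    intro p hp
    exact Subtype.ext (hinj p.1 p.2 (congrArg (fun z => z.1.1) hp))
  have hrange : LinearMap.range Φ = M ⊓ LinearMap.ker ev := by
    rw [hker, LinearMap.range_coprod, LinearMap.range_comp, LinearMap.range_comp,
      Submodule.range_subtype, Submodule.range_subtype]
  have hkerE : Module.finrank ℂ (LinearMap.ker E) = Module.finrank ℂ (LinearMap.range Φ) := by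
    have : Submodule.map M.subtype (LinearMap.ker E) = M ⊓ LinearMap.ker ev := by
      ext p
      constructor
      · rintro ⟨q, hq, rfl⟩
        exact ⟨q.2, congrArg Subtype.val hq⟩
      · rintro ⟨hp, hp'⟩
        exact ⟨⟨p, hp⟩, Subtype.ext hp', rfl⟩
    rw [hrange, ← this, Submodule.finrank_map_subtype_eq]
  have d₁ := finrank_add_finrank_range_le hΨinj hΨ
  have d₂ := LinearMap.finrank_range_add_finrank_ker E
  have d₃ := Submodule.finrank_le (LinearMap.range E)
  rw [Module.finrank_prod] at d₁
  constructor
  · have : LinearMap.range E = ⊤ := Submodule.eq_top_of_finrank_eq (by omega)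
    intro f hf
    obtain ⟨p, hp⟩ := LinearMap.range_eq_top.1 this ⟨f, hf⟩
    exact ⟨p.1, p.2, congrArg Subtype.val hp⟩
  · intro A hA B hB h
    obtain ⟨D, hD⟩ := exists_of_finrank_eq hΨinj hΨ (by rw [Module.finrank_prod]; omega)
      (w := (⟨A, hA⟩, ⟨B, hB⟩)) h
    exact ⟨D.1, D.2, (congrArg (fun z => z.1.1) hD).symm, (congrArg (fun z => z.2.1) hD).symm⟩

end Scroll

/-! ### Generation and syzygies of the ideal of a complete intersection -/

namespace Scroll

open MvPolynomial

theorem monomial_mul_mem_AdmSub_iff {e : Fin 3 → ℤ} {n : ℕ} {m : ℤ} {r : ℕ}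
    {p : MvPolynomial (Fin 4) ℂ} :
    monomial (Finsupp.single 0 r) 1 * p ∈ AdmSub e n m ↔ p ∈ AdmSub e n (m + r) := by
  constructor
  · intro h μ hμ
    have h' := h (Finsupp.single 0 r + μ) (by
      rwa [mem_support_iff, coeff_monomial_mul, one_mul, ← mem_support_iff])
    rw [admissible_iff, len_add, wt_add] at h'
    have h1 : len (Finsupp.single 0 r) = 0 := by simp [len]
    have h2 : wt e (Finsupp.single 0 r) = 0 := by simp [wt]
    rw [admissible_iff]
    rw [h1, h2, Finsupp.add_apply, Finsupp.single_eq_same] at h'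
    push_cast at h'
    omega
  · intro h
    have : monomial (Finsupp.single 0 r) 1 ∈ AdmSub e 0 (-r) :=
      monomial_mem_mon (s := {μ | admissible e 0 (-r) μ}) (by simp [admissible]) 1
    exact AdmSub_mul_mem this h (zero_add n) (by omega)

theorem AdmSub_mono {e : Fin 3 → ℤ} {n : ℕ} {m m' : ℤ} (h : m ≤ m') :
    AdmSub e n m' ≤ AdmSub e n m :=
  fun _ hp μ hμ => ⟨(hp μ hμ).1, by have := (hp μ hμ).2; omega⟩

/-- The sections of bidegree `(n - 2, m)`. -/
def low (e : Fin 3 → ℤ) : ℕ → ℤ → Submodule ℂ (MvPolynomial (Fin 4) ℂ)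
  | 0, _ => ⊥
  | 1, _ => ⊥
  | n + 2, m => AdmSub e n m

theorem mul_mem_of_mem_low {e : Fin 3 → ℤ} {n : ℕ} {s t r : ℤ} {p q : MvPolynomial (Fin 4) ℂ}
    (hq : q ∈ AdmSub e 2 r) (hp : p ∈ low e n s) (ht : t ≤ s + r) : q * p ∈ AdmSub e n t := by
  match n, hp with
  | 0, hp => rw [(Submodule.mem_bot ℂ).1 hp, mul_zero]; exact zero_mem _
  | 1, hp => rw [(Submodule.mem_bot ℂ).1 hp, mul_zero]; exact zero_mem _
  | n + 2, hp => exact AdmSub_mul_mem hq hp (add_comm _ _) (by omega)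

theorem six_mul_finrank_low {e : Fin 3 → ℤ} {n : ℕ} {m c : ℤ} (he : ∀ i, c ≤ e i)
    (hm : m ≤ c * (n - 2) + 1) :
    6 * (Module.finrank ℂ (low e n m) : ℤ) =
      3 * (1 - m) * n * (n - 1) + (e 0 + e 1 + e 2) * n * (n - 1) * (n - 2) := by
  match n with
  | 0 =>
    rw [show Module.finrank ℂ (low e 0 m) = 0 from finrank_bot ℂ _]
    simp
  | 1 =>
    rw [show Module.finrank ℂ (low e 1 m) = 0 from finrank_bot ℂ _]
    simp
  | n + 2 =>
    refine (six_mul_finrank_AdmSub (n := n) he ?_).trans ?_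
    · push_cast at hm
      rwa [add_sub_cancel_right] at hm
    · push_cast
      ring

theorem exists_of_mem_low {e : Fin 3 → ℤ} {n r : ℕ} {s : ℤ}
    (hr : ∀ μ, len μ + 2 = n → r ≤ wt e μ + len μ + 1 - s) {p : MvPolynomial (Fin 4) ℂ}
    (hp : p ∈ low e n (s - 1)) :
    ∃ q, ∃ p' ∈ low e n s, p = monomial (Finsupp.single 0 r) 1 * q + p' := by
  match n, hp with
  | 0, hp => exact ⟨0, 0, zero_mem _, by rw [(Submodule.mem_bot ℂ).1 hp]; simp⟩
  | 1, hp => exact ⟨0, 0, zero_mem _, by rw [(Submodule.mem_bot ℂ).1 hp]; simp⟩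
  | n + 2, hp =>
    obtain ⟨q, -, hq⟩ := exists_eq_monomial_mul (x₀ := Finsupp.single 0 r) (t := Set.univ)
      (sub_tr_mem (s := {μ | admissible e n s μ}) (t := {μ | admissible e n (s - 1) μ}) hp) (by
        rintro μ ⟨h, h'⟩
        rw [Set.mem_ofPred_eq, admissible_iff] at h h'
        have := hr μ (by omega)
        refine ⟨μ - Finsupp.single 0 r, trivial, (add_tsub_cancel_of_le ?_).symm⟩
        rw [Finsupp.single_le_iff]
        omega)
    exact ⟨q, _, tr_mem {μ | admissible e n s μ} p, by rw [← hq]; ring⟩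

variable {F : Type} [Field F] [Algebra ℂ F]

/-- The kernel of restriction to the curve in bidegree `(l + 2, m)` is generated by the two
equations. -/
def Gen (ev : MvPolynomial (Fin 4) ℂ →ₐ[ℂ] F) (e : Fin 3 → ℤ) (a b : ℤ)
    (Q₁ Q₂ : MvPolynomial (Fin 4) ℂ) (l : ℕ) (m : ℤ) : Prop :=
  AdmSub e (l + 2) m ⊓ LinearMap.ker ev.toLinearMap =
    Submodule.map (LinearMap.mulLeft ℂ Q₁) (AdmSub e l (m - a)) ⊔
      Submodule.map (LinearMap.mulLeft ℂ Q₂) (AdmSub e l (m - b))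

/-- The syzygies between the two equations in bidegree `(l + 2, m)` are trivial. -/
def Syz (e : Fin 3 → ℤ) (a b : ℤ) (Q₁ Q₂ : MvPolynomial (Fin 4) ℂ) (l : ℕ) (m : ℤ) : Prop :=
  ∀ A ∈ AdmSub e l (m - a), ∀ B ∈ AdmSub e l (m - b), Q₁ * A + Q₂ * B = 0 →
    ∃ D ∈ low e l (m - a - b), A = Q₂ * D ∧ B = -(Q₁ * D)

variable {ev : MvPolynomial (Fin 4) ℂ →ₐ[ℂ] F} {e : Fin 3 → ℤ} {a b : ℤ}
  {Q₁ Q₂ : MvPolynomial (Fin 4) ℂ}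

theorem Gen.exists_eq {l : ℕ} {m : ℤ} (h : Gen ev e a b Q₁ Q₂ l m) {p : MvPolynomial (Fin 4) ℂ}
    (hp : p ∈ AdmSub e (l + 2) m) (hev : ev p = 0) :
    ∃ A ∈ AdmSub e l (m - a), ∃ B ∈ AdmSub e l (m - b), p = Q₁ * A + Q₂ * B := by
  obtain ⟨_, ⟨A, hA, rfl⟩, _, ⟨B, hB, rfl⟩, h⟩ := Submodule.mem_sup.1 (h.le ⟨hp, hev⟩)
  exact ⟨A, hA, B, hB, h.symm⟩

theorem Gen.of_exists {l : ℕ} {m : ℤ} (hQ₁ : Q₁ ∈ AdmSub e 2 a) (hQ₂ : Q₂ ∈ AdmSub e 2 b)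
    (hev₁ : ev Q₁ = 0) (hev₂ : ev Q₂ = 0)
    (h : ∀ p ∈ AdmSub e (l + 2) m, ev p = 0 →
      ∃ A ∈ AdmSub e l (m - a), ∃ B ∈ AdmSub e l (m - b), p = Q₁ * A + Q₂ * B) :
    Gen ev e a b Q₁ Q₂ l m := by
  refine le_antisymm ?_ (sup_le ?_ ?_)
  · rintro p ⟨hp, hp'⟩
    obtain ⟨A, hA, B, hB, rfl⟩ := h p hp hp'
    exact Submodule.add_mem_sup ⟨A, hA, rfl⟩ ⟨B, hB, rfl⟩
  · rintro _ ⟨A, hA, rfl⟩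
    refine ⟨AdmSub_mul_mem hQ₁ hA (add_comm _ _) (by omega), ?_⟩
    change ev (Q₁ * A) = 0
    rw [map_mul, hev₁, zero_mul]
  · rintro _ ⟨A, hA, rfl⟩
    refine ⟨AdmSub_mul_mem hQ₂ hA (add_comm _ _) (by omega), ?_⟩
    change ev (Q₂ * A) = 0
    rw [map_mul, hev₂, zero_mul]

theorem Gen.step {l k : ℕ} (hQ₁ : Q₁ ∈ AdmSub e 2 a) (hQ₂ : Q₂ ∈ AdmSub e 2 b)
    (hev₁ : ev Q₁ = 0) (hev₂ : ev Q₂ = 0) (h0 : Gen ev e a b Q₁ Q₂ l 0)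
    (hsyz : Syz e a b Q₁ Q₂ l (-1))
    (hk : ∀ μ, len μ + 2 = l → (k + 1 : ℕ) ≤ wt e μ + len μ + 1 - (-a - b))
    (h : Gen ev e a b Q₁ Q₂ l k) : Gen ev e a b Q₁ Q₂ l (k + 1 : ℕ) := by
  refine Gen.of_exists hQ₁ hQ₂ hev₁ hev₂ fun p hp hp' => ?_
  obtain ⟨A, hA, B, hB, hAB⟩ := h.exists_eq (AdmSub_mono (by omega) hp) hp'
  set X : MvPolynomial (Fin 4) ℂ := monomial (Finsupp.single 0 (k + 1)) 1 with hX
  obtain ⟨A', hA', B', hB', hAB'⟩ := h0.exists_eq (p := X * p)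
    (monomial_mul_mem_AdmSub_iff.2 (by rwa [zero_add])) (by rw [map_mul, hp', mul_zero])
  obtain ⟨D, hD, hDA, hDB⟩ := hsyz (X * A - A')
    (sub_mem (monomial_mul_mem_AdmSub_iff.2 (AdmSub_mono (by omega) hA))
      (AdmSub_mono (by omega) hA')) (X * B - B')
    (sub_mem (monomial_mul_mem_AdmSub_iff.2 (AdmSub_mono (by omega) hB))
      (AdmSub_mono (by omega) hB'))
    (by linear_combination hAB' - X * hAB)
  obtain ⟨q, D', hD', rfl⟩ := exists_of_mem_low hk (s := -a - b)
    (by rwa [show -a - b - 1 = -1 - a - b by ring])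
  rw [← hX] at hDA hDB
  refine ⟨A - Q₂ * q, ?_, B + Q₁ * q, ?_, by rw [hAB]; ring⟩
  · rw [← neg_add_eq_sub, ← monomial_mul_mem_AdmSub_iff, ← hX,
      show X * (A - Q₂ * q) = A' + Q₂ * D' by linear_combination hDA]
    exact add_mem (AdmSub_mono (by omega) hA') (mul_mem_of_mem_low hQ₂ hD' (by omega))
  · rw [← neg_add_eq_sub, ← monomial_mul_mem_AdmSub_iff, ← hX,
      show X * (B + Q₁ * q) = B' - Q₁ * D' by linear_combination hDB]
    exact sub_mem (AdmSub_mono (by omega) hB') (mul_mem_of_mem_low hQ₁ hD' (by omega))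

end Scroll

/-! ### Sections of line bundles on the curve -/

namespace Curve

variable (C : Curve)

instance (D : C.Div) : FiniteDimensional ℂ (C.H0 D) := C.finiteDim D

/-- The degree as a homomorphism. -/
def degHom : C.Div →+ ℤ := Finsupp.liftAddHom fun _ => AddMonoidHom.id ℤ

theorem deg_eq_degHom (D : C.Div) : C.deg D = C.degHom D := rfl

theorem h0_eq_zero_of_deg_neg {D : C.Div} (h : C.deg D < 0) : C.h0 D = 0 := by
  have : C.H0 D = ⊥ := by
    rw [Submodule.eq_bot_iff]
    intro f hf
    by_contra hf0
    have hf : ∀ P, 0 ≤ C.ord P f + D P := (C.mem_H0.1 hf).resolve_left hf0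
    have hD : C.deg D = ∑ᶠ P, D P :=
      (finsum_eq_sum_of_support_subset _ (by simp)).symm
    have h0 := finsum_nonneg hf
    rw [finsum_add_distrib (C.ord_finite_support f hf0) D.hasFiniteSupport,
      C.deg_principal f hf0, ← hD] at h0
    omega
  rw [PreCurve.h0, this, finrank_bot]

theorem deg_K : C.deg C.K = 2 * C.genus - 2 := by
  have h1 := C.riemann_roch 0
  have h2 := C.riemann_roch C.K
  rw [sub_zero, deg_eq_degHom, map_zero] at h1
  rw [sub_self] at h2
  omega

theorem h0_K : C.h0 C.K = C.genus := by
  have h1 := C.riemann_roch 0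
  rw [sub_zero, deg_eq_degHom, map_zero, C.h0_triv] at h1
  omega

theorem h0_nsmul_K_sub {T : C.Div} (hT : C.deg T = 4) {n : ℕ} {m : ℤ}
    (h : 4 * m < (n - 1) * (2 * C.genus - 2)) :
    (C.h0 (n • C.K - m • T) : ℤ) = n * (2 * C.genus - 2) - 4 * m + 1 - C.genus := by
  have hK := C.deg_K
  rw [deg_eq_degHom] at hK hT
  have hrr := C.riemann_roch (n • C.K - m • T)
  rw [C.h0_eq_zero_of_deg_neg (D := C.K - (n • C.K - m • T))] at hrr
  · rw [deg_eq_degHom, map_sub, map_nsmul, map_zsmul, hK, hT, smul_eq_mul, nsmul_eq_mul] at hrr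
    push_cast at hrr
    linarith
  · rw [deg_eq_degHom, map_sub, map_sub, map_nsmul, map_zsmul, hK, hT, smul_eq_mul,
      nsmul_eq_mul]
    linarith

theorem one_mem_H0 : (1 : C.F) ∈ C.H0 0 := by
  have := (C.RL 0).one_mem
  change (1 : C.F) ∈ C.H0 ((0 : ℕ) • 0) at this
  rwa [zero_smul] at this

theorem pow_mem_H0 {D : C.Div} {f : C.F} (hf : f ∈ C.H0 D) (n : ℕ) : f ^ n ∈ C.H0 (n • D) := by
  induction n with
  | zero => simpa using C.one_mem_H0
  | succ n ih =>
    rw [pow_succ, succ_nsmul]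
    exact C.mul_mem_H0 ih hf

theorem RL_connectedOne (L : C.Div) : (C.RL L).ConnectedOne := by
  change C.H0 ((0 : ℕ) • L) = Submodule.span ℂ {1}
  rw [zero_smul]
  refine (Submodule.eq_of_le_of_finrank_eq ?_ ?_).symm
  · rw [Submodule.span_singleton_le_iff_mem]
    exact C.one_mem_H0
  · rw [finrank_span_singleton one_ne_zero]
    exact C.h0_triv.symm

end Curve

namespace ScrollData

open Scroll

variable {C : Curve} {T : C.Div} {e : Fin 3 → ℤ} (sd : ScrollData C T e)

/-- Restriction to the curve as an algebra homomorphism. -/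
abbrev ev : MvPolynomial (Fin 4) ℂ →ₐ[ℂ] C.F := MvPolynomial.aeval (C.scrollVars sd.x sd.w)

theorem ev_monomial (μ : Fin 4 →₀ ℕ) (c : ℂ) : sd.ev (MvPolynomial.monomial μ c) =
    c • (sd.x ^ μ 0 * sd.w 0 ^ μ 1 * sd.w 1 ^ μ 2 * sd.w 2 ^ μ 3) := by
  rw [MvPolynomial.aeval_monomial, Finsupp.prod_fintype _ _ (by simp), Fin.prod_univ_four,
    Algebra.smul_def]
  rfl

theorem h0_K_sub (sd : ScrollData C T e) (m : ℕ) :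
    C.h0 (C.K - m • T) = ∑ i, (e i - m + 1).toNat := by
  let b (t : Σ i : Fin 3, Fin (e i - m + 1).toNat) : C.F := sd.x ^ (t.2 : ℕ) * sd.w t.1
  have hb : LinearIndependent ℂ b := by
    refine sd.indep.comp (fun t : Σ i : Fin 3, Fin (e i - m + 1).toNat => (t.1, (t.2 : ℕ))) ?_
    rintro ⟨i, j⟩ ⟨i', j'⟩ h
    obtain ⟨h1, h2⟩ := Prod.mk.inj h
    obtain rfl : i = i' := h1
    obtain rfl : j = j' := Fin.ext h2
    rfl
  have hr : Set.range b =
      {f : C.F | ∃ (i : Fin 3) (j : ℕ), (j : ℤ) ≤ e i - m ∧ f = sd.x ^ j * sd.w i} := by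
    ext f
    constructor
    · rintro ⟨⟨i, j⟩, rfl⟩
      exact ⟨i, j, by have := j.2; omega, rfl⟩
    · rintro ⟨i, j, hj, rfl⟩
      exact ⟨⟨i, ⟨j, by omega⟩⟩, rfl⟩
  have := finrank_span_eq_card hb
  rw [hr, sd.span_KmT] at this
  exact this.trans (by simp)

theorem x_mem : sd.x ∈ C.H0 T := by
  rw [← sd.pencil_span]
  exact Submodule.subset_span (by simp)

theorem w_mem {i : Fin 3} (hi : 0 ≤ e i) : sd.w i ∈ C.H0 (C.K - e i • T) := by
  obtain ⟨k, hk⟩ := Int.eq_ofNat_of_zero_le hi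
  rw [hk, natCast_zsmul, ← sd.span_KmT]
  exact Submodule.subset_span ⟨i, 0, by omega, by simp⟩

theorem ev_mem (hT : ∀ P, 0 ≤ T P) (he : ∀ i, 0 ≤ e i) {n : ℕ} {m : ℤ}
    {p : MvPolynomial (Fin 4) ℂ} (hp : p ∈ AdmSub e n m) : sd.ev p ∈ C.H0 (n • C.K - m • T) := by
  rw [p.as_sum, map_sum]
  refine sum_mem fun μ hμ => ?_
  rw [ev_monomial]
  refine Submodule.smul_mem _ _ ?_
  have h := C.mul_mem_H0 (C.mul_mem_H0 (C.mul_mem_H0 (C.pow_mem_H0 sd.x_mem (μ 0))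
    (C.pow_mem_H0 (sd.w_mem (he 0)) (μ 1))) (C.pow_mem_H0 (sd.w_mem (he 1)) (μ 2)))
    (C.pow_mem_H0 (sd.w_mem (he 2)) (μ 3))
  refine C.H0_mono (fun P => ?_) h
  obtain ⟨h1, h2⟩ := hp μ hμ
  rw [Fin.sum_univ_three] at h1 h2
  change μ 1 + μ 2 + μ 3 = n at h1
  change (μ 0 : ℤ) + m ≤ (μ 1 : ℤ) * e 0 + (μ 2 : ℤ) * e 1 + (μ 3 : ℤ) * e 2 at h2
  simp only [Finsupp.add_apply, Finsupp.sub_apply, Finsupp.smul_apply, nsmul_eq_mul,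
    smul_eq_mul, ← h1]
  push_cast
  nlinarith [mul_le_mul_of_nonneg_right h2 (hT P)]

theorem e_nonneg_and_sum (sd : ScrollData C T e) (hTdeg : C.deg T = 4)
    (hTh0 : C.h0 T = 2) (hg : 9 ≤ C.genus) :
    (∀ i, 0 ≤ e i) ∧ e 0 + e 1 + e 2 = C.genus - 3 := by
  have h0 := sd.h0_K_sub 0
  have h1 := sd.h0_K_sub 1
  have hrr := C.riemann_roch T
  rw [zero_smul, sub_zero, C.h0_K, Fin.sum_univ_three] at h0
  rw [one_smul, Fin.sum_univ_three] at h1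
  push_cast at h0 h1
  have : 0 ≤ e 0 ∧ 0 ≤ e 1 ∧ 0 ≤ e 2 := by omega
  obtain ⟨e0, e1, e2⟩ := this
  refine ⟨fun i => ?_, by omega⟩
  fin_cases i <;> assumption

end ScrollData

namespace ScrollData

open Scroll

variable {C : Curve} {T : C.Div} {e : Fin 3 → ℤ} {a b : ℤ} {Q₁ Q₂ : MvPolynomial (Fin 4) ℂ}

theorem neg_mul_mem_hyp {n : ℕ} {D : MvPolynomial (Fin 4) ℂ} (hD : D ∈ low e n (n - a)) :
    -(Q₁ * D) ∈ hyp e Q₁ a n := by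
  refine neg_mem ?_
  match n, hD with
  | 0, hD => rw [(Submodule.mem_bot ℂ).1 hD, mul_zero]; exact zero_mem _
  | 1, hD => rw [(Submodule.mem_bot ℂ).1 hD, mul_zero]; exact zero_mem _
  | n + 2, hD => exact ⟨D, by push_cast at hD; exact hD, rfl⟩

/-- In the range without higher cohomology, generation of the ideal by the two equations implies
surjectivity of restriction to the curve and triviality of syzygies. -/
theorem surjective_and_syz (sd : ScrollData C T e) (hTdeg : C.deg T = 4) (hT : ∀ P, 0 ≤ T P)
    (hg : (C.genus : ℤ) = a + b + 5) (ha : 2 ≤ a) (hb : 2 ≤ b) (he0 : ∀ i, 0 ≤ e i)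
    (hS : e 0 + e 1 + e 2 = a + b + 2) (hQ₁ : Q₁ ∈ AdmSub e 2 a) (hQ₂ : Q₂ ∈ AdmSub e 2 b)
    {l : ℕ} {m c : ℤ} (hc1 : c ≤ 1) (hc : ∀ i, c ≤ e i) (hm : m ≤ c * (l + 2))
    (hQ₂0 : l = 0 ∨ Q₂ ≠ 0) (hgen : Gen sd.ev e a b Q₁ Q₂ l m) :
    (∀ f ∈ C.H0 ((l + 2) • C.K - m • T), ∃ p ∈ AdmSub e (l + 2) m, sd.ev p = f) ∧
      Syz e a b Q₁ Q₂ l m := by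
  have hml : m ≤ l + 2 := by nlinarith
  refine surjective_and_syzygy sd.ev.toLinearMap Q₁ Q₂ (AdmSub e (l + 2) m) (AdmSub e l (m - a))
    (AdmSub e l (m - b)) (low e l (m - a - b)) (C.H0 ((l + 2) • C.K - m • T))
    (fun p hp => sd.ev_mem hT he0 hp) hgen
    (fun p hp => mul_mem_of_mem_low hQ₂ hp (by omega))
    (fun p hp => mul_mem_of_mem_low hQ₁ hp (by omega)) ?_ ?_
  · intro p hp h
    rcases hQ₂0 with rfl | h0
    · exact (Submodule.mem_bot ℂ).1 hp
    · exact (mul_eq_zero.1 h).resolve_left h0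
  · have d₁ := six_mul_finrank_AdmSub (n := l + 2) (m := m) hc (by push_cast; linarith)
    have d₂ := six_mul_finrank_AdmSub (n := l) (m := m - a) hc (by linarith)
    have d₃ := six_mul_finrank_AdmSub (n := l) (m := m - b) hc (by linarith)
    have d₄ := six_mul_finrank_low (n := l) (m := m - a - b) hc (by linarith)
    have d₅ := C.h0_nsmul_K_sub hTdeg (n := l + 2) (m := m) (by
      rw [hg]
      push_cast
      nlinarith [mul_nonneg (Nat.cast_nonneg (α := ℤ) l) (by linarith : 0 ≤ a + b)])
    rw [hS] at d₁ d₂ d₃ d₄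
    rw [hg] at d₅
    rw [PreCurve.h0] at d₅
    push_cast at d₁ d₅
    zify
    have : 6 * ((Module.finrank ℂ (AdmSub e (l + 2) m) : ℤ) +
        Module.finrank ℂ (low e l (m - a - b))) = 6 * (Module.finrank ℂ (AdmSub e l (m - a)) +
          Module.finrank ℂ (AdmSub e l (m - b)) +
            Module.finrank ℂ (C.H0 ((l + 2) • C.K - m • T))) := by
      rw [mul_add, mul_add, mul_add, d₁, d₂, d₃, d₄, d₅]
      ring
    linarith

/-- The scroll has no section contracted by `O(1)`. -/
theorem one_le_e (sd : ScrollData C T e) (hTdeg : C.deg T = 4) (hT : ∀ P, 0 ≤ T P)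
    (hg : (C.genus : ℤ) = a + b + 5) (ha : 2 ≤ a) (hb : 2 ≤ b) (he0 : ∀ i, 0 ≤ e i)
    (hS : e 0 + e 1 + e 2 = a + b + 2) (hgen : Gen sd.ev e a b Q₁ Q₂ 0 2) (i : Fin 3) :
    1 ≤ e i := by
  by_contra hi
  have hi : e i = 0 := by have := he0 i; omega
  let E : AdmSub e 2 2 →ₗ[ℂ] C.H0 (2 • C.K - (2 : ℤ) • T) :=
    sd.ev.toLinearMap.restrict fun p hp => sd.ev_mem hT he0 hp
  have d₁ := LinearMap.finrank_range_add_finrank_ker E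
  have d₂ := Submodule.finrank_le (LinearMap.range E)
  have d₃ := C.h0_nsmul_K_sub hTdeg (n := 2) (m := 2) (by rw [hg]; push_cast; linarith)
  have d₄ : Module.finrank ℂ (LinearMap.ker E) ≤
      Module.finrank ℂ (AdmSub e 0 (2 - a)) + Module.finrank ℂ (AdmSub e 0 (2 - b)) := by
    have h : Submodule.map (AdmSub e 2 2).subtype (LinearMap.ker E) ≤
        AdmSub e 2 2 ⊓ LinearMap.ker sd.ev.toLinearMap := by
      rintro _ ⟨q, hq, rfl⟩
      exact ⟨q.2, congrArg Subtype.val hq⟩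
    rw [← Submodule.finrank_map_subtype_eq]
    refine (Submodule.finrank_mono (h.trans hgen.le)).trans ?_
    refine (Submodule.finrank_add_le_finrank_add_finrank _ _).trans ?_
    exact add_le_add (Submodule.finrank_map_le _ _) (Submodule.finrank_map_le _ _)
  have d₅ := six_mul_finrank_AdmSub (n := 0) (m := 2 - a) he0 (by linarith)
  have d₆ := six_mul_finrank_AdmSub (n := 0) (m := 2 - b) he0 (by linarith)
  have d₇ := finrank_AdmSub e 2 2
  simp only [Finset.sum_range_succ, Finset.sum_range_zero] at d₇
  push_cast at d₃ d₅ d₆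
  rw [PreCurve.h0] at d₃
  fin_cases i <;> simp at hi <;> simp at d₇ <;> omega

theorem CI.symm {sd : ScrollData C T e} (h : sd.CI a b Q₁ Q₂) : sd.CI b a Q₂ Q₁ :=
  ⟨h.2.1, h.1, h.2.2.2.1, h.2.2.1, fun n m hm => (h.2.2.2.2 n m hm).trans (sup_comm _ _)⟩

/-- Koszulness when the second quadric has type `O(2)(-2H)`. -/
theorem isKoszul_of_eq_two (sd : ScrollData C T e) (hTdeg : C.deg T = 4) (hTh0 : C.h0 T = 2)
    (hT : ∀ P, 0 ≤ T P) (hab : a + b = (C.genus : ℤ) - 5) (hCI : sd.CI a b Q₁ Q₂) (ha : 2 ≤ a)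
    (hb : b = 2) : (C.RL (C.K - T)).IsKoszul := by
  have hg : (C.genus : ℤ) = a + b + 5 := by omega
  obtain ⟨he0, hS⟩ := sd.e_nonneg_and_sum hTdeg hTh0 (by omega)
  have hS : e 0 + e 1 + e 2 = a + b + 2 := by omega
  obtain ⟨hQ₁, hQ₂, hev₁, hev₂, hgen⟩ := hCI
  change sd.ev Q₁ = 0 at hev₁
  change sd.ev Q₂ = 0 at hev₂
  have hgen (l : ℕ) (m : ℤ) (hm : m ≤ 0) : Gen sd.ev e a b Q₁ Q₂ l m := hgen l m hm
  have hss {l : ℕ} {m c : ℤ} (hc1 : c ≤ 1) (hc : ∀ i, c ≤ e i) (hm : m ≤ c * (l + 2))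
      (hQ₂0 : l = 0 ∨ Q₂ ≠ 0) (h : Gen sd.ev e a b Q₁ Q₂ l m) :=
    sd.surjective_and_syz hTdeg hT hg ha (by omega) he0 hS hQ₁ hQ₂ hc1 hc hm hQ₂0 h
  have hsyz0 := (hss zero_le_one he0 (by simp) (Or.inl rfl) (hgen 0 0 le_rfl)).2
  have hone {s : ℤ} (hs : s ≤ 0) : (1 : MvPolynomial (Fin 4) ℂ) ∈ AdmSub e 0 s :=
    AdmSub_mono hs (one_mem_AdmSub e)
  have hQ₁0 : Q₁ ≠ 0 := by
    rintro rfl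
    obtain ⟨D, hD, h, -⟩ := hsyz0 1 (hone (by omega)) 0 (zero_mem _) (by simp)
    rw [(Submodule.mem_bot ℂ).1 hD, mul_zero] at h
    exact one_ne_zero h
  have hQ₂0 : Q₂ ≠ 0 := by
    rintro rfl
    obtain ⟨D, hD, -, h⟩ := hsyz0 0 (zero_mem _) 1 (hone (by omega)) (by simp)
    rw [(Submodule.mem_bot ℂ).1 hD, mul_zero, neg_zero] at h
    exact one_ne_zero h
  have hsyz (l : ℕ) : Syz e a b Q₁ Q₂ l (-1) :=
    (hss zero_le_one he0 (by simp) (Or.inr hQ₂0) (hgen l (-1) (by omega))).2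
  have hstep (l k : ℕ) (hk : ∀ μ, len μ + 2 = l → (k : ℤ) ≤ wt e μ + len μ + 5) :
      Gen sd.ev e a b Q₁ Q₂ l k := by
    induction k with
    | zero => exact hgen l 0 le_rfl
    | succ k ih =>
      refine Gen.step hQ₁ hQ₂ hev₁ hev₂ (hgen l 0 le_rfl) (hsyz l) (fun μ hμ => ?_)
        (ih fun μ hμ => ?_)
      all_goals
        have := hk μ hμ
        push_cast at this ⊢
        omega
  have he := sd.one_le_e hTdeg hT hg ha (by omega) he0 hS
    (hstep 0 2 fun μ hμ => absurd hμ (by omega))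
  have hwt (μ) : 0 ≤ wt e μ := Finset.sum_nonneg fun i _ =>
    mul_nonneg (Nat.cast_nonneg _) (by have := he i; omega)
  have hfin (l : ℕ) : Gen sd.ev e a b Q₁ Q₂ l (l + 2 : ℕ) := hstep l (l + 2) fun μ hμ => by
    have := hwt μ
    push_cast
    omega
  have hss' (l : ℕ) := hss le_rfl he (by push_cast; linarith) (Or.inr hQ₂0) (hfin l)
  have hpiece (n : ℕ) : (C.RL (C.K - T)).piece n = C.H0 (n • C.K - (n : ℤ) • T) := by
    change C.H0 (n • (C.K - T)) = _
    rw [smul_sub, natCast_zsmul]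
  have hev (n : ℕ) (p) (hp : p ∈ AdmSub e n n) : sd.ev p ∈ (C.RL (C.K - T)).piece n := by
    rw [hpiece]
    exact sd.ev_mem hT he0 hp
  have hsurj (n : ℕ) (f) (hf : f ∈ (C.RL (C.K - T)).piece n) :
      ∃ p ∈ AdmSub e n n, sd.ev p = f := by
    match n with
    | 0 =>
      rw [C.RL_connectedOne, Submodule.mem_span_singleton] at hf
      obtain ⟨c, rfl⟩ := hf
      exact ⟨c • 1, Submodule.smul_mem _ _ (one_mem_AdmSub e), by rw [map_smul, map_one]⟩
    | 1 =>
      rw [hpiece, one_smul, Nat.cast_one, one_smul] at hf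
      have h := sd.span_KmT 1
      rw [one_smul] at h
      rw [← h] at hf
      have hle : Submodule.span ℂ {f : C.F | ∃ (i : Fin 3) (j : ℕ), (j : ℤ) ≤ e i - (1 : ℕ) ∧
          f = sd.x ^ j * sd.w i} ≤ Submodule.map sd.ev.toLinearMap (AdmSub e 1 1) := by
        rw [Submodule.span_le]
        rintro _ ⟨i, j, hj, rfl⟩
        refine ⟨MvPolynomial.monomial (Finsupp.single 0 j + Finsupp.single i.succ 1) 1,
          monomial_mem_mon (s := {μ | admissible e 1 1 μ}) ?_ 1, ?_⟩
        · fin_cases i <;> simp [admissible, Fin.sum_univ_three] <;>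
            simp at hj <;> omega
        · change sd.ev _ = _
          rw [ev_monomial]
          fin_cases i <;> simp
      exact hle hf
    | n + 2 =>
      rw [hpiece] at hf
      exact (hss' n).1 f hf
  have : FiniteDimensional ℂ ((C.RL (C.K - T)).piece 1) := C.finiteDim _
  refine isKoszul_of_complete_intersection (C.RL (C.K - T)) (C.RL_connectedOne _) he ha hQ₁ hQ₁0
    (by rwa [hb] at hQ₂) sd.ev hev hsurj ?_ hev₁ hev₂ ?_ ?_
  · intro p hp hp0
    let E : AdmSub e 1 1 →ₗ[ℂ] (C.RL (C.K - T)).piece 1 :=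
      sd.ev.toLinearMap.restrict (hev 1)
    have hE : LinearMap.range E = ⊤ := by
      rw [LinearMap.range_eq_top]
      rintro ⟨f, hf⟩
      obtain ⟨p, hp, rfl⟩ := hsurj 1 f hf
      exact ⟨⟨p, hp⟩, rfl⟩
    have d₁ := LinearMap.finrank_range_add_finrank_ker E
    have d₂ := six_mul_finrank_AdmSub (n := 1) (m := 1) he0 (by simp)
    have d₃ := sd.h0_K_sub 1
    have d₄ : Module.finrank ℂ ((C.RL (C.K - T)).piece 1) = C.h0 (C.K - 1 • T) := by
      rw [hpiece, one_smul, Nat.cast_one, one_smul, one_smul]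
      rfl
    rw [Fin.sum_univ_three] at d₃
    rw [hE, finrank_top] at d₁
    push_cast at d₂ d₃
    have := he0 0
    have := he0 1
    have := he0 2
    have hk : LinearMap.ker E = ⊥ := by
      rw [← Submodule.finrank_eq_zero (R := ℂ)]
      omega
    exact congrArg Subtype.val
      (LinearMap.ker_eq_bot'.1 hk ⟨p, hp⟩ (Subtype.ext hp0))
  · intro n p hp hp0
    obtain ⟨A, hA, B, hB, h⟩ := (hfin n).exists_eq (by push_cast; exact hp) hp0
    push_cast at hA hB
    exact ⟨A, hA, B, by rwa [hb, add_sub_cancel_right] at hB, h⟩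
  · intro n A hA B hB h
    obtain ⟨D, hD, -, rfl⟩ := (hss' n).2 A (by push_cast; exact hA) B
      (by push_cast; rwa [hb, add_sub_cancel_right]) h
    refine neg_mul_mem_hyp ?_
    push_cast at hD
    rwa [hb, show (n : ℤ) + 2 - a - 2 = n - a by ring] at hD

end ScrollData

/-!  ### STATEMENT 14

Let `C` be a non-hyperelliptic smooth connected projective complex curve of genus `g`
with a base-point-free tetragonal system `T`, presented as a complete intersection of
divisors `S₁ ∈ |O_X(2)(-aH)|` and `S₂ ∈ |O_X(2)(-bH)|` on a 3-dimensional rational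
normal scroll `X = P(V^∨)`, with `a + b = g - 5` and `T = H|_C`.  If `a, b ≥ 2` and
moreover `a = 2` or `b = 2`, then the algebra `R_{K(-T)}` is Koszul.  In particular
`R_{K(-T)}` is Koszul whenever `g = 9` or `g = 10` (and `a, b ≥ 2`). -/
theorem tetragonal_koszul_of_low_type (C : Curve) (T : C.Div)
    (hHE : ¬ C.Hyperelliptic)
    (hTdeg : C.deg T = 4) (hTh0 : C.h0 T = 2) (hTbpf : C.BasePointFree T)
    (hTeff : ∀ P, 0 ≤ T P)
    (e : Fin 3 → ℤ) (a b : ℤ) (hab : a + b = (C.genus : ℤ) - 5)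
    (sd : ScrollData C T e) (Q₁ Q₂ : MvPolynomial (Fin 4) ℂ)
    (hCI : sd.CI a b Q₁ Q₂)
    (ha : 2 ≤ a) (hb : 2 ≤ b) :
    ((a = 2 ∨ b = 2) → (C.RL (C.K - T)).IsKoszul) ∧
    ((C.genus = 9 ∨ C.genus = 10) → (C.RL (C.K - T)).IsKoszul) := by
  have main : a = 2 ∨ b = 2 → (C.RL (C.K - T)).IsKoszul := by
    rintro (h | h)
    · exact sd.isKoszul_of_eq_two hTdeg hTh0 hTeff ((add_comm b a).trans hab) hCI.symm hb h
    · exact sd.isKoszul_of_eq_two hTdeg hTh0 hTeff hab hCI ha h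
  exact ⟨main, fun _ => main (by omega)⟩

end
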